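/- arXiv:1404.0182 — 3 statements merged into one kernel-verified Lean document; each statement's English description precedes it below -/
import Mathlib

section
/- There is an absolute constant C such that for every prime p and every real T ≥ 1, the quantity Q_{T,p} = #{(u₁/v₁, u₂/v₂) ∈ F(T) × F(T) : gcd(v₁v₂, p) = 1 and u₁/v₁ ≡ u₂/v₂ (mod p)} satisfies Q_{T,p} ≤ C (T⁴/p + T² (log p)²). -/
open Polynomial Finset

attribute [local instance 10] Classical.propDecidable

noncomputable section

/-- The discriminant polynomial `Δ = -16(4f³+27g²)`. -/
def Dpoly (f g : Polynomial ℤ) : Polynomial ℤ := -16 * (4 * f ^ 3 + 27 * g ^ 2)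

/-- Nondegeneracy: `Δ ≠ 0` as a polynomial and the `j`-invariant
`j = -1728(4f)³/Δ` is not a constant rational function, i.e. `-1728(4f)³`
is not a rational multiple of `Δ`. -/
def Nondeg (f g : Polynomial ℤ) : Prop :=
  Dpoly f g ≠ 0 ∧
    ¬∃ c : ℚ, (-1728 : Polynomial ℚ) * (4 * f.map (Int.castRingHom ℚ)) ^ 3 =
      Polynomial.C c * (Dpoly f g).map (Int.castRingHom ℚ)

/-- The set `F(T) = {u/v ∈ ℚ : gcd(u,v) = 1, 1 ≤ u, v ≤ T}`. -/
def FT (T : ℝ) : Finset ℚ :=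
  ((Finset.Icc (1 : ℤ) ⌊T⌋ ×ˢ Finset.Icc (1 : ℤ) ⌊T⌋).filter
      fun w => Int.gcd w.1 w.2 = 1).image fun w => (w.1 : ℚ) / (w.2 : ℚ)

/-- Reduction of a rational number `t` modulo `p`, as `num·den⁻¹` in `ZMod p`. -/
def redQ (p : ℕ) (t : ℚ) : ZMod p := (t.num : ZMod p) * (t.den : ZMod p)⁻¹

/-- The number of `𝔽_p`-points of the curve `Y² = X³ + AX + B`
(affine points together with the point at infinity). -/
def numPoints (p : ℕ) (A B : ZMod p) : ℕ :=
  1 + Nat.card {P : ZMod p × ZMod p // P.2 ^ 2 = P.1 ^ 3 + A * P.1 + B}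

/-- The Frobenius trace `p + 1 - #E(𝔽_p)` of `Y² = X³ + AX + B` over `𝔽_p`. -/
def frobTrace (p : ℕ) (A B : ZMod p) : ℤ := (p : ℤ) + 1 - numPoints p A B

/-- `a_p(E(t))`: the Frobenius trace of the reduction modulo `p` of the curve
`E(t) : Y² = X³ + f(t)X + g(t)`. -/
def apE (f g : Polynomial ℤ) (p : ℕ) (t : ℚ) : ℤ :=
  frobTrace p ((f.map (Int.castRingHom (ZMod p))).eval (redQ p t))
    ((g.map (Int.castRingHom (ZMod p))).eval (redQ p t))

/-- Good reduction of `E(t)` at `p`: the denominator of `t` is coprime to `p`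
and `Δ(t) ≢ 0 (mod p)`. -/
def goodRed (f g : Polynomial ℤ) (p : ℕ) (t : ℚ) : Prop :=
  ¬(p ∣ t.den) ∧ ((Dpoly f g).map (Int.castRingHom (ZMod p))).eval (redQ p t) ≠ 0

/-- `π_{E(t)}(𝔄; x)`: the number of primes `p ≤ x` of good reduction for `E(t)`
with `a_p(E(t)) = a_p`. -/
def piSeq (f g : Polynomial ℤ) (a : ℕ → ℤ) (t : ℚ) (x : ℝ) : ℕ :=
  ((Finset.Icc 1 ⌊x⌋₊).filter fun p =>
      p.Prime ∧ goodRed f g p t ∧ apE f g p t = a p).card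

/-- `π_{E(t)}(K; x)` for `K = ℚ(√d)`: the number of primes `p ≤ x` of good
reduction for `E(t)` with `a_p(E(t)) ≠ 0` and `a_p(E(t))² - 4p = d·m²`. -/
def piK (f g : Polynomial ℤ) (d : ℤ) (t : ℚ) (x : ℝ) : ℕ :=
  ((Finset.Icc 1 ⌊x⌋₊).filter fun p =>
      p.Prime ∧ goodRed f g p t ∧ apE f g p t ≠ 0 ∧
        ∃ m : ℤ, 0 < m ∧ (apE f g p t) ^ 2 - 4 * (p : ℤ) = d * m ^ 2).card

/-- The Frobenius angle `ψ_p(E(t)) ∈ [0, π]`, with `cos ψ_p = a_p/(2√p)`. -/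
def psiE (f g : Polynomial ℤ) (p : ℕ) (t : ℚ) : ℝ :=
  Real.arccos ((apE f g p t : ℝ) / (2 * Real.sqrt p))

/-- `π_{E(t)}(α, β; x)`: the number of primes `p ≤ x` of good reduction for
`E(t)` with `ψ_p(E(t)) ∈ [α, β]`. -/
def piAngle (f g : Polynomial ℤ) (α β : ℝ) (t : ℚ) (x : ℝ) : ℕ :=
  ((Finset.Icc 1 ⌊x⌋₊).filter fun p =>
      p.Prime ∧ goodRed f g p t ∧ psiE f g p t ∈ Set.Icc α β).card

/-- The Sato–Tate density `μ_ST(α, β) = (2/π) ∫_α^β sin²θ dθ`. -/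
def muST (α β : ℝ) : ℝ := (2 / Real.pi) * ∫ θ in α..β, Real.sin θ ^ 2

/-- `π(x)`: the number of primes `p ≤ x`. -/
def primePi (x : ℝ) : ℕ := ((Finset.Icc 1 ⌊x⌋₊).filter Nat.Prime).card

/-- `e_p(w) = exp(2πi w/p)`. -/
def ep (p : ℕ) (w : ZMod p) : ℂ :=
  Complex.exp (2 * (Real.pi : ℂ) * Complex.I * (w.val : ℂ) / (p : ℂ))

lemma FT_mem_bounds {T : ℝ} {q : ℚ} (hq : q ∈ FT T) :
    0 < q.num ∧ (q.num : ℝ) ≤ T ∧ (q.den : ℝ) ≤ T := by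
  simp only [FT, Finset.mem_image, Finset.mem_filter, Finset.mem_product, Finset.mem_Icc] at hq
  obtain ⟨⟨u, v⟩, ⟨⟨⟨hu, huT⟩, hv, hvT⟩, hg⟩, rfl⟩ := hq
  have hnum : ((u : ℚ) / v).num = u := Rat.num_div_eq_of_coprime (by lia) hg
  have hden : (((u : ℚ) / v).den : ℤ) = v := Rat.den_div_eq_of_coprime (by lia) hg
  refine ⟨by rw [hnum]; lia, by rw [hnum]; exact Int.le_floor.mp huT, ?_⟩
  have hden' : (((u : ℚ) / v).den : ℝ) = (v : ℝ) := by exact_mod_cast hden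
  rw [hden']
  exact Int.le_floor.mp hvT

lemma FT_card_le {T : ℝ} (hT : 1 ≤ T) : ((FT T).card : ℝ) ≤ T ^ 2 := by
  have h : (FT T).card ≤ ⌊T⌋.toNat * ⌊T⌋.toNat := by
    refine Finset.card_image_le.trans ((Finset.card_filter_le _ _).trans ?_)
    simp [Finset.card_product]
  have hfl : ((⌊T⌋.toNat : ℕ) : ℝ) ≤ T := Nat.floor_le (by linarith)
  calc ((FT T).card : ℝ) ≤ (⌊T⌋.toNat : ℝ) * (⌊T⌋.toNat : ℝ) := by exact_mod_cast h
    _ ≤ T * T := by gcongr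
    _ = T ^ 2 := by ring

/-- Congruent rationals have cross determinant divisible by `p`. -/
lemma dvd_det_of_redQ_eq {p : ℕ} (hp : p.Prime) {a b : ℚ} (ha : ¬p ∣ a.den) (hb : ¬p ∣ b.den)
    (h : redQ p a = redQ p b) : (p : ℤ) ∣ a.num * b.den - b.num * a.den := by
  have : Fact p.Prime := ⟨hp⟩
  have ha' : (a.den : ZMod p) ≠ 0 := fun h0 => ha ((ZMod.natCast_eq_zero_iff _ _).mp h0)
  have hb' : (b.den : ZMod p) ≠ 0 := fun h0 => hb ((ZMod.natCast_eq_zero_iff _ _).mp h0)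
  unfold redQ at h
  field_simp at h
  rw [← ZMod.intCast_zmod_eq_zero_iff_dvd]
  push_cast
  rw [sub_eq_zero]
  linear_combination h

/-- The map `u / v ↦ ⌊4T²/p · u / (u + v)⌋`, which separates congruent elements of `FT T`. -/
def slopeIndex (T : ℝ) (p : ℕ) (q : ℚ) : ℕ :=
  ⌊4 * T ^ 2 / p * (q.num / (q.num + q.den))⌋₊

lemma slopeIndex_lt {T : ℝ} {p : ℕ} {q : ℚ} (hq : q ∈ FT T) :
    slopeIndex T p q < ⌊4 * T ^ 2 / p⌋₊ + 1 := by
  obtain ⟨h0, -, -⟩ := FT_mem_bounds hq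
  have h0' : (0 : ℝ) < q.num := by exact_mod_cast h0
  refine Nat.lt_succ_of_le (Nat.floor_le_floor ?_)
  refine mul_le_of_le_one_right (by positivity) ?_
  rw [div_le_one (by positivity)]
  have : (0 : ℝ) ≤ q.den := by positivity
  linarith

lemma eq_of_slopeIndex_eq {T : ℝ} {p : ℕ} (hp : p.Prime) {a b : ℚ} (ha : a ∈ FT T)
    (hb : b ∈ FT T) (had : ¬p ∣ a.den) (hbd : ¬p ∣ b.den) (h : redQ p a = redQ p b)
    (hs : slopeIndex T p a = slopeIndex T p b) : a = b := by
  by_contra hne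
  obtain ⟨ha0, haT, haT'⟩ := FT_mem_bounds ha
  obtain ⟨hb0, hbT, hbT'⟩ := FT_mem_bounds hb
  have hdet : a.num * b.den - b.num * a.den ≠ 0 := fun h0 =>
    hne (Rat.eq_iff_mul_eq_mul.mpr (by linarith))
  have hle : (p : ℤ) ≤ |a.num * b.den - b.num * a.den| :=
    Int.le_of_dvd (abs_pos.mpr hdet) ((dvd_abs _ _).mpr (dvd_det_of_redQ_eq hp had hbd h))
  have hle' : (p : ℝ) ≤ |(a.num : ℝ) * b.den - b.num * a.den| := by exact_mod_cast hle
  have ha0' : (0 : ℝ) < a.num := by exact_mod_cast ha0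
  have hb0' : (0 : ℝ) < b.num := by exact_mod_cast hb0
  have had0 : (0 : ℝ) < a.den := by exact_mod_cast a.den_pos
  have hbd0 : (0 : ℝ) < b.den := by exact_mod_cast b.den_pos
  have hp0 : (0 : ℝ) < p := by exact_mod_cast hp.pos
  have hprod : ((a.num : ℝ) + a.den) * (b.num + b.den) ≤ 4 * T ^ 2 := by
    calc ((a.num : ℝ) + a.den) * (b.num + b.den) ≤ (T + T) * (T + T) := by gcongr; linarith
      _ = 4 * T ^ 2 := by ring
  have hpos : 0 < ((a.num : ℝ) + a.den) * (b.num + b.den) := by positivity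
  have hT : 0 < 4 * T ^ 2 / p := div_pos (hpos.trans_le hprod) hp0
  have hlt : |4 * T ^ 2 / p * ((a.num : ℝ) / (a.num + a.den)) -
      4 * T ^ 2 / p * ((b.num : ℝ) / (b.num + b.den))| < 1 := by
    refine Int.abs_sub_lt_one_of_floor_eq_floor ?_
    rw [← Int.natCast_floor_eq_floor (by positivity), ← Int.natCast_floor_eq_floor (by positivity)]
    exact congrArg Nat.cast hs
  refine hlt.not_ge ?_
  have heq : 4 * T ^ 2 / p * ((a.num : ℝ) / (a.num + a.den)) -
      4 * T ^ 2 / p * ((b.num : ℝ) / (b.num + b.den)) =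
      4 * T ^ 2 / p * (((a.num : ℝ) * b.den - b.num * a.den) /
        ((a.num + a.den) * (b.num + b.den))) := by
    field_simp
    ring
  rw [heq, abs_mul, abs_of_pos hT, abs_div, abs_of_pos hpos, div_mul_div_comm,
    one_le_div (by positivity), mul_comm (p : ℝ)]
  gcongr

/-- Lemma 2.4: the number `Q_{T,p}` of pairs of elements of `F(T)` with
denominators coprime to `p` that are congruent modulo `p` satisfies
`Q_{T,p} ≤ C (T⁴/p + T² (log p)²)`. -/
theorem QTp_bound :
    ∃ C : ℝ, 0 < C ∧ ∀ p : ℕ, p.Prime → ∀ T : ℝ, 1 ≤ T →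
      ((((FT T ×ˢ FT T).filter fun q =>
          ¬(p ∣ q.1.den) ∧ ¬(p ∣ q.2.den) ∧ redQ p q.1 = redQ p q.2).card : ℕ) : ℝ) ≤
        C * (T ^ 4 / p + T ^ 2 * Real.log p ^ 2) := by
  refine ⟨4, by norm_num, fun p hp T hT => ?_⟩
  have hcount := Finset.card_le_mul_card_image_of_maps_to
    (s := (FT T ×ˢ FT T).filter fun q =>
      ¬(p ∣ q.1.den) ∧ ¬(p ∣ q.2.den) ∧ redQ p q.1 = redQ p q.2)
    (t := FT T) (f := Prod.fst)
    (fun x hx => (Finset.mem_product.mp (Finset.mem_filter.mp hx).1).1)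
    (⌊4 * T ^ 2 / p⌋₊ + 1) (by
      intro b _
      rw [← Finset.card_range (⌊4 * T ^ 2 / p⌋₊ + 1)]
      refine Finset.card_le_card_of_injOn (fun q => slopeIndex T p q.2) ?_ ?_
      · intro q hq
        simp only [Finset.coe_filter, Finset.mem_filter, Finset.mem_product,
          Set.mem_ofPred_eq] at hq
        simpa using Nat.lt_succ_iff.mp (slopeIndex_lt hq.1.1.2)
      · rintro ⟨a, x⟩ hx ⟨a', y⟩ hy hs
        simp only [Finset.coe_filter, Finset.mem_filter, Finset.mem_product,
          Set.mem_ofPred_eq] at hx hy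
        obtain ⟨⟨⟨-, hx⟩, -, hxd, hxr⟩, rfl⟩ := hx
        obtain ⟨⟨⟨-, hy⟩, -, hyd, hyr⟩, rfl⟩ := hy
        rw [eq_of_slopeIndex_eq hp hx hy hxd hyd (hxr.symm.trans hyr) hs])
  have hfl : (⌊4 * T ^ 2 / p⌋₊ : ℝ) ≤ 4 * T ^ 2 / p := Nat.floor_le (by positivity)
  have hlog : 1 ≤ 4 * Real.log p ^ 2 := by
    have h2 : Real.log 2 ≤ Real.log p :=
      Real.log_le_log (by norm_num) (by exact_mod_cast hp.two_le)
    nlinarith [Real.log_two_gt_d9]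
  refine (Nat.cast_le.mpr hcount).trans ?_
  push_cast
  calc ((⌊4 * T ^ 2 / p⌋₊ : ℝ) + 1) * (FT T).card
      ≤ (4 * T ^ 2 / p + 4 * Real.log p ^ 2) * T ^ 2 := by
        gcongr
        exact FT_card_le hT
    _ = 4 * (T ^ 4 / p + T ^ 2 * Real.log p ^ 2) := by ring
end
end

section
/- For every ε > 0 there is a constant C (depending only on ε) such that for every prime p and every real T ≥ 1, one has max_{a ∈ 𝔽_p^*} | Σ_{u/v ∈ F(T), gcd(v,p)=1} e_p(a·u/v) | ≤ C T (Tp)^ε, where u/v is evaluated in 𝔽_p as u·v⁻¹. -/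
open Polynomial Finset

attribute [local instance 10] Classical.propDecidable

noncomputable section

/-- The divisor bound: the number of divisors of `n` is `O(n ^ ε)`. -/
theorem exists_card_divisors_le_rpow (ε : ℝ) (hε : 0 < ε) :
    ∃ C : ℝ, 1 ≤ C ∧ ∀ n : ℕ, n ≠ 0 → (n.divisors.card : ℝ) ≤ C * (n : ℝ) ^ ε := by
  set K : ℝ := max 1 (1 / (ε * Real.log 2)) with hK
  set Q : ℕ := ⌈(2 : ℝ) ^ (1 / ε)⌉₊ with hQ
  have hlog : 0 < Real.log 2 := Real.log_pos one_lt_two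
  have hK1 : 1 ≤ K := le_max_left _ _
  refine ⟨K ^ Q, one_le_pow₀ hK1, fun n hn ↦ ?_⟩
  have local_bound : ∀ q ∈ n.primeFactors, ((n.factorization q : ℝ) + 1) ≤
      (if q < Q then K else 1) * ((q : ℝ) ^ n.factorization q) ^ ε := by
    intro q hq
    have hq2 : (2 : ℝ) ≤ q := by exact_mod_cast (Nat.prime_of_mem_primeFactors hq).two_le
    have hq0 : (0 : ℝ) ≤ q := by linarith
    set e := n.factorization q
    have hcomm : ((q : ℝ) ^ e) ^ ε = ((q : ℝ) ^ ε) ^ e := by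
      rw [← Real.rpow_natCast, ← Real.rpow_natCast, ← Real.rpow_mul hq0, ← Real.rpow_mul hq0,
        mul_comm]
    split_ifs with hlt
    · have h1 : 1 + ε * e * Real.log 2 ≤ ((q : ℝ) ^ e) ^ ε := by
        calc 1 + ε * e * Real.log 2 ≤ Real.exp (Real.log 2 * (ε * e)) := by
              have := Real.add_one_le_exp (Real.log 2 * (ε * e)); linarith
          _ = ((2 : ℝ) ^ e) ^ ε := by
              rw [← Real.rpow_natCast, ← Real.rpow_mul zero_le_two, Real.rpow_def_of_pos two_pos,
                mul_comm ε]
          _ ≤ _ := by gcongr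
      have h2 : 1 ≤ K * (ε * Real.log 2) := by
        rw [← div_le_iff₀ (by positivity)]; exact le_max_right _ _
      calc (e : ℝ) + 1 ≤ K * (ε * Real.log 2) * e + K := by
            have : (0 : ℝ) ≤ e := by positivity
            nlinarith
        _ = K * (1 + ε * e * Real.log 2) := by ring
        _ ≤ _ := by gcongr
    · have h1 : (2 : ℝ) ≤ (q : ℝ) ^ ε := by
        have : (2 : ℝ) ^ (1 / ε) ≤ q := (Nat.le_ceil _).trans (by exact_mod_cast not_lt.mp hlt)
        calc (2 : ℝ) = ((2 : ℝ) ^ (1 / ε)) ^ ε := by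
              rw [← Real.rpow_mul zero_le_two, one_div_mul_cancel hε.ne', Real.rpow_one]
          _ ≤ _ := by gcongr
      rw [one_mul, hcomm]
      calc (e : ℝ) + 1 ≤ (2 : ℝ) ^ e := by exact_mod_cast Nat.lt_two_pow_self (n := e)
        _ ≤ _ := by gcongr
  rw [Nat.card_divisors hn]
  push_cast
  calc ∏ q ∈ n.primeFactors, ((n.factorization q : ℝ) + 1)
      ≤ ∏ q ∈ n.primeFactors, ((if q < Q then K else 1) * ((q : ℝ) ^ n.factorization q) ^ ε) :=
        Finset.prod_le_prod (fun _ _ ↦ by positivity) local_bound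
    _ = K ^ (n.primeFactors.filter (· < Q)).card * (n : ℝ) ^ ε := by
        rw [Finset.prod_mul_distrib, Finset.prod_ite, Finset.prod_const, Finset.prod_const_one,
          mul_one, Real.finsetProd_rpow _ _ (fun _ _ ↦ by positivity)]
        congr 2
        conv_rhs => rw [← Nat.prod_factorization_pow_eq_self hn]
        rw [Finsupp.prod]; push_cast; rfl
    _ ≤ K ^ Q * (n : ℝ) ^ ε := by
        gcongr
        calc _ ≤ (Finset.range Q).card := Finset.card_le_card fun q hq ↦ by
              simpa using (Finset.mem_filter.mp hq).2
          _ = Q := Finset.card_range Q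

/-- The harmonic sums are `O(n ^ ε)`. -/
theorem exists_sum_inv_le_rpow (ε : ℝ) (hε : 0 < ε) :
    ∃ C : ℝ, 1 ≤ C ∧ ∀ n : ℕ, 1 ≤ n → ∑ k ∈ Finset.Icc 1 n, (k : ℝ)⁻¹ ≤ C * (n : ℝ) ^ ε := by
  refine ⟨1 + 1 / ε, by simp [hε.le], fun n hn ↦ ?_⟩
  have hn' : (1 : ℝ) ≤ n := by exact_mod_cast hn
  have h1 := harmonic_le_one_add_log n
  rw [harmonic_eq_sum_Icc] at h1
  push_cast at h1
  have h2 := Real.log_le_rpow_div (x := n) (by positivity) hε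
  have h3 := Real.one_le_rpow hn' hε.le
  calc _ ≤ 1 + Real.log n := h1
    _ ≤ (n : ℝ) ^ ε + (n : ℝ) ^ ε / ε := by linarith
    _ = _ := by ring

theorem ep_eq_stdAddChar (p : ℕ) [NeZero p] (w : ZMod p) : ep p w = ZMod.stdAddChar w := by
  rw [ZMod.stdAddChar_apply, ZMod.toCircle_apply, ep]

theorem norm_ep (p : ℕ) [NeZero p] (w : ZMod p) : ‖ep p w‖ = 1 := by
  rw [ep_eq_stdAddChar, ZMod.stdAddChar_apply, Circle.norm_coe]

/-- `‖e_p(z) - 1‖` is at least four times the distance from `z / p` to the nearest integer. -/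
theorem le_norm_ep_sub_one (p : ℕ) [NeZero p] (z : ZMod p) :
    4 * |(z.valMinAbs : ℝ)| / p ≤ ‖ep p z - 1‖ := by
  have hp : (0 : ℝ) < p := by exact_mod_cast Nat.pos_of_ne_zero (NeZero.ne p)
  have habs : |(z.valMinAbs : ℝ)| ≤ p / 2 := by
    have h1 : (z.valMinAbs.natAbs : ℝ) ≤ ((p / 2 : ℕ) : ℝ) := by
      exact_mod_cast z.natAbs_valMinAbs_le
    rw [Nat.cast_natAbs, Int.cast_abs] at h1
    exact h1.trans Nat.cast_div_le
  have hz : ep p z = Complex.exp (Complex.I * ((2 * Real.pi * z.valMinAbs / p : ℝ) : ℂ)) := by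
    conv_lhs => rw [ep_eq_stdAddChar, ← z.coe_valMinAbs, ZMod.stdAddChar_coe]
    congr 1
    push_cast
    ring
  rw [hz, Complex.norm_exp_I_mul_ofReal_sub_one]
  have hx : 2 * Real.pi * z.valMinAbs / p / 2 = Real.pi * (z.valMinAbs / p) := by ring
  have habs' : |Real.pi * (z.valMinAbs / p : ℝ)| = Real.pi * (|(z.valMinAbs : ℝ)| / p) := by
    rw [abs_mul, abs_div, abs_of_pos Real.pi_pos, abs_of_pos hp]
  have h := Real.mul_abs_le_abs_sin (x := Real.pi * (z.valMinAbs / p)) (by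
    rw [habs', div_eq_mul_inv Real.pi]
    gcongr
    rw [div_le_iff₀ hp]; linarith)
  rw [habs'] at h
  rw [hx, norm_mul, Real.norm_eq_abs, Real.norm_eq_abs, abs_of_pos (two_pos : (0 : ℝ) < 2)]
  calc _ = 2 * (2 / Real.pi * (Real.pi * (|(z.valMinAbs : ℝ)| / p))) := by
        field_simp; ring
    _ ≤ _ := by gcongr

theorem norm_sum_ep_le_card (p : ℕ) [NeZero p] (z : ZMod p) (M : ℕ) :
    ‖∑ u ∈ Finset.Icc 1 M, ep p ((u : ZMod p) * z)‖ ≤ M := by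
  refine (norm_sum_le _ _).trans ?_
  simp [norm_ep]

/-- The geometric progression bound for linear exponential sums modulo `p`. -/
theorem norm_sum_ep_mul_abs_le (p : ℕ) [NeZero p] (z : ZMod p) (M : ℕ) :
    ‖∑ u ∈ Finset.Icc 1 M, ep p ((u : ZMod p) * z)‖ * |(z.valMinAbs : ℝ)| ≤ p := by
  have hp : (0 : ℝ) < p := by exact_mod_cast Nat.pos_of_ne_zero (NeZero.ne p)
  have hpow : ∀ u : ℕ, ep p ((u : ZMod p) * z) = ep p z ^ u := fun u ↦ by
    rw [ep_eq_stdAddChar, ep_eq_stdAddChar, ← nsmul_eq_mul, AddChar.map_nsmul_eq_pow]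
  have hgeom : (∑ u ∈ Finset.Icc 1 M, ep p ((u : ZMod p) * z)) * (ep p z - 1) =
      ep p z ^ (M + 1) - ep p z := by
    rw [Finset.sum_congr rfl fun u _ ↦ hpow u, ← Finset.Ico_add_one_right_eq_Icc,
      geom_sum_Ico_mul _ (by omega), pow_one]
  have hnorm : ‖∑ u ∈ Finset.Icc 1 M, ep p ((u : ZMod p) * z)‖ * ‖ep p z - 1‖ ≤ 2 := by
    rw [← norm_mul, hgeom]
    refine (norm_sub_le _ _).trans ?_
    rw [norm_pow, norm_ep]; norm_num
  have h := (mul_le_mul_of_nonneg_left (le_norm_ep_sub_one p z)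
    (norm_nonneg (∑ u ∈ Finset.Icc 1 M, ep p ((u : ZMod p) * z)))).trans hnorm
  rw [mul_div_assoc', div_le_iff₀ hp] at h
  nlinarith

/-- The exponential sum over all pairs `(u, v)` of positive integers up to `M` with `p ∤ v`. -/
def pairSum (p : ℕ) (a : ZMod p) (M : ℕ) : ℂ :=
  ∑ v ∈ Finset.Icc 1 M, if p ∣ v then 0 else
    ∑ u ∈ Finset.Icc 1 M, ep p ((u : ZMod p) * (a * (v : ZMod p)⁻¹))

theorem val_add_mul_ne_zero {p : ℕ} [NeZero p] {a : ZMod p} (ha : a ≠ 0) (k : ℤ) :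
    (a.val : ℤ) + k * p ≠ 0 := fun h ↦ ha <| by
  simpa using congrArg (Int.cast : ℤ → ZMod p) h

/-- The inner sum over `u` is controlled by the integer `k` for which the least residue `s` of
`a / v` satisfies `s * v = a + k * p`. -/
theorem exists_dvd_val_add_mul {p : ℕ} [Fact p.Prime] {a : ZMod p} {M v : ℕ}
    (hv : v ∈ Finset.Icc 1 M) (hpv : ¬p ∣ v) :
    ∃ k : ℤ, v ∣ ((a.val : ℤ) + k * p).natAbs ∧ ((a.val : ℤ) + k * p).natAbs ≤ p * M ∧
      k.natAbs ≤ M + 1 ∧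
      ‖∑ u ∈ Finset.Icc 1 M, ep p ((u : ZMod p) * (a * (v : ZMod p)⁻¹))‖ ≤
        3 * M * ((k.natAbs + 1 : ℕ) : ℝ)⁻¹ := by
  obtain ⟨hv1, hvM⟩ := Finset.mem_Icc.mp hv
  have hp : 0 < p := (Fact.out : p.Prime).pos
  have hv0 : (v : ZMod p) ≠ 0 := by rwa [Ne, ZMod.natCast_eq_zero_iff]
  set z := a * (v : ZMod p)⁻¹ with hz
  set s := z.valMinAbs with hs
  have hcast : ((s * v - a.val : ℤ) : ZMod p) = 0 := by
    push_cast
    rw [hs, z.coe_valMinAbs, ZMod.natCast_zmod_val, hz, mul_assoc, inv_mul_cancel₀ hv0, mul_one,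
      sub_self]
  obtain ⟨k, hk⟩ := (ZMod.intCast_zmod_eq_zero_iff_dvd _ p).mp hcast
  have hn : (a.val : ℤ) + k * p = s * v := by linarith
  have hsp : s.natAbs ≤ p := z.natAbs_valMinAbs_le.trans (Nat.div_le_self _ _)
  have hbound : ((a.val : ℤ) + k * p).natAbs ≤ p * M := by
    rw [hn, Int.natAbs_mul, Int.natAbs_natCast]
    exact Nat.mul_le_mul hsp hvM
  have hap : a.val < p := a.val_lt
  have hkn : k.natAbs * p ≤ ((a.val : ℤ) + k * p).natAbs + p := by
    have h : (k * p).natAbs = k.natAbs * p := by rw [Int.natAbs_mul, Int.natAbs_natCast]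
    omega
  refine ⟨k, ?_, hbound, ?_, ?_⟩
  · rw [hn, Int.natAbs_mul, Int.natAbs_natCast]
    exact dvd_mul_left _ _
  · refine Nat.le_of_mul_le_mul_right (c := p) ?_ hp
    nlinarith
  · rw [← div_eq_mul_inv, le_div_iff₀ (by positivity)]
    have h1 := norm_sum_ep_le_card p z M
    have h2 := norm_sum_ep_mul_abs_le p z M
    set t := ‖∑ u ∈ Finset.Icc 1 M, ep p ((u : ZMod p) * z)‖
    have ht : 0 ≤ t := norm_nonneg _
    have hp' : (0 : ℝ) < p := by exact_mod_cast hp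
    have h3 : (k.natAbs : ℝ) * p ≤ |(s : ℝ)| * v + p := by
      rw [hn, Int.natAbs_mul, Int.natAbs_natCast] at hkn
      have : ((k.natAbs * p : ℕ) : ℝ) ≤ ((s.natAbs * v + p : ℕ) : ℝ) := by exact_mod_cast hkn
      push_cast [Nat.cast_natAbs] at this ⊢
      exact this
    have hvM' : (v : ℝ) ≤ M := by exact_mod_cast hvM
    have hv' : (0 : ℝ) ≤ v := by positivity
    push_cast
    refine le_of_mul_le_mul_right ?_ hp'
    calc t * (k.natAbs + 1) * p = t * (k.natAbs * p) + t * p := by ring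
      _ ≤ t * (|(s : ℝ)| * v + p) + t * p := by gcongr
      _ = t * |(s : ℝ)| * v + 2 * (t * p) := by ring
      _ ≤ p * M + 2 * (M * p) := by gcongr
      _ = 3 * M * p := by ring

theorem exists_norm_pairSum_le (ε : ℝ) (hε : 0 < ε) :
    ∃ C : ℝ, 0 < C ∧ ∀ p : ℕ, p.Prime → ∀ a : ZMod p, a ≠ 0 → ∀ M : ℕ, 1 ≤ M →
      ‖pairSum p a M‖ ≤ C * M * ((p : ℝ) * M) ^ ε := by
  obtain ⟨C₁, hC₁, hdiv⟩ := exists_card_divisors_le_rpow (ε / 2) (by positivity)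
  obtain ⟨C₂, hC₂, hharm⟩ := exists_sum_inv_le_rpow (ε / 2) (by positivity)
  refine ⟨6 * C₁ * C₂ * 3 ^ (ε / 2), by positivity, fun p hp a ha M hM ↦ ?_⟩
  have : Fact p.Prime := ⟨hp⟩
  have hp1 : (1 : ℝ) ≤ p := by exact_mod_cast hp.one_le
  have hM1 : (1 : ℝ) ≤ M := by exact_mod_cast hM
  set S := (Finset.Icc 1 M).filter fun v ↦ ¬p ∣ v with hS
  set t : ℕ → ℂ := fun v ↦ ∑ u ∈ Finset.Icc 1 M, ep p ((u : ZMod p) * (a * (v : ZMod p)⁻¹))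
    with ht
  have hsum : pairSum p a M = ∑ v ∈ S, t v := by
    rw [pairSum, hS, Finset.sum_filter]
    exact Finset.sum_congr rfl fun v _ ↦ by simp only [ite_not, ht]
  have hex : ∀ v, ∃ k : ℤ, v ∈ S → v ∣ ((a.val : ℤ) + k * p).natAbs ∧
      ((a.val : ℤ) + k * p).natAbs ≤ p * M ∧ k.natAbs ≤ M + 1 ∧
      ‖t v‖ ≤ 3 * M * ((k.natAbs + 1 : ℕ) : ℝ)⁻¹ := fun v ↦ by
    by_cases hv : v ∈ S
    · obtain ⟨hv1, hv2⟩ := Finset.mem_filter.mp hv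
      obtain ⟨k, hk⟩ := exists_dvd_val_add_mul (a := a) hv1 hv2
      exact ⟨k, fun _ ↦ hk⟩
    · exact ⟨0, fun h ↦ absurd h hv⟩
  choose k hk using hex
  set D : ℝ := C₁ * ((p : ℝ) * M) ^ (ε / 2) with hD
  have hD0 : 0 ≤ D := by positivity
  have hfib : ∀ l : ℤ, ((S.filter fun v ↦ k v = l).card : ℝ) ≤ D := fun l ↦ by
    rcases (S.filter fun v ↦ k v = l).eq_empty_or_nonempty with h | ⟨w, hw⟩
    · rw [h]; simpa using hD0
    · obtain ⟨hwS, hwl⟩ := Finset.mem_filter.mp hw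
      have hn0 : ((a.val : ℤ) + l * p).natAbs ≠ 0 :=
        Int.natAbs_ne_zero.mpr (val_add_mul_ne_zero ha l)
      have hle : ((a.val : ℤ) + l * p).natAbs ≤ p * M := hwl ▸ (hk w hwS).2.1
      calc ((S.filter fun v ↦ k v = l).card : ℝ)
          ≤ (((a.val : ℤ) + l * p).natAbs.divisors.card : ℝ) := by
            refine Nat.cast_le.mpr <| Finset.card_le_card fun v hv ↦ ?_
            obtain ⟨hvS, hvl⟩ := Finset.mem_filter.mp hv
            exact Nat.mem_divisors.mpr ⟨hvl ▸ (hk v hvS).1, hn0⟩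
        _ ≤ C₁ * (((a.val : ℤ) + l * p).natAbs : ℝ) ^ (ε / 2) := hdiv _ hn0
        _ ≤ D := by
            rw [hD]
            gcongr
            exact_mod_cast hle
  have hfib' : ∀ j : ℕ, ((S.filter fun v ↦ (k v).natAbs + 1 = j).card : ℝ) ≤ 2 * D := fun j ↦ by
    calc ((S.filter fun v ↦ (k v).natAbs + 1 = j).card : ℝ)
        ≤ (((S.filter fun v ↦ k v = (j : ℤ) - 1) ∪
            S.filter fun v ↦ k v = -((j : ℤ) - 1)).card : ℝ) := by
          refine Nat.cast_le.mpr <| Finset.card_le_card fun v hv ↦ ?_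
          obtain ⟨hvS, hvj⟩ := Finset.mem_filter.mp hv
          simp only [Finset.mem_union, Finset.mem_filter, hvS, true_and]
          omega
      _ ≤ ((S.filter fun v ↦ k v = (j : ℤ) - 1).card : ℝ) +
            (S.filter fun v ↦ k v = -((j : ℤ) - 1)).card := by
          exact_mod_cast Finset.card_union_le _ _
      _ ≤ 2 * D := by linarith [hfib ((j : ℤ) - 1), hfib (-((j : ℤ) - 1))]
  have hmaps : ∀ v ∈ S, (k v).natAbs + 1 ∈ Finset.Icc 1 (M + 2) := fun v hv ↦ by
    have := (hk v hv).2.2.1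
    rw [Finset.mem_Icc]; omega
  calc ‖pairSum p a M‖ ≤ ∑ v ∈ S, ‖t v‖ := hsum ▸ norm_sum_le _ _
    _ ≤ ∑ v ∈ S, 3 * M * (((k v).natAbs + 1 : ℕ) : ℝ)⁻¹ :=
        Finset.sum_le_sum fun v hv ↦ (hk v hv).2.2.2
    _ = ∑ j ∈ Finset.Icc 1 (M + 2), ∑ v ∈ S.filter fun v ↦ (k v).natAbs + 1 = j,
          3 * M * (((k v).natAbs + 1 : ℕ) : ℝ)⁻¹ :=
        (Finset.sum_fiberwise_of_maps_to hmaps _).symm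
    _ = ∑ j ∈ Finset.Icc 1 (M + 2),
          ((S.filter fun v ↦ (k v).natAbs + 1 = j).card : ℝ) * (3 * M * (j : ℝ)⁻¹) := by
        refine Finset.sum_congr rfl fun j _ ↦ ?_
        rw [Finset.sum_congr rfl fun v hv ↦ by rw [(Finset.mem_filter.mp hv).2],
          Finset.sum_const, nsmul_eq_mul]
    _ ≤ ∑ j ∈ Finset.Icc 1 (M + 2), 2 * D * (3 * M * (j : ℝ)⁻¹) := by
        gcongr with j _
        exact hfib' j
    _ = 6 * D * M * ∑ j ∈ Finset.Icc 1 (M + 2), (j : ℝ)⁻¹ := by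
        rw [Finset.mul_sum]
        exact Finset.sum_congr rfl fun j _ ↦ by ring
    _ ≤ 6 * D * M * (C₂ * ((M + 2 : ℕ) : ℝ) ^ (ε / 2)) := by
        gcongr
        exact hharm _ (by omega)
    _ ≤ 6 * D * M * (C₂ * (3 * ((p : ℝ) * M)) ^ (ε / 2)) := by
        gcongr
        push_cast
        nlinarith
    _ = 6 * C₁ * C₂ * 3 ^ (ε / 2) * M * (((p : ℝ) * M) ^ (ε / 2) * ((p : ℝ) * M) ^ (ε / 2)) := by
        rw [hD, Real.mul_rpow (x := 3) (by norm_num) (by positivity)]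
        ring
    _ = _ := by
        rw [← Real.rpow_add (by positivity), add_halves]

theorem sum_Icc_filter_dvd {E : Type*} [AddCommMonoid E] (N d : ℕ) (hd : 0 < d) (f : ℕ → E) :
    ∑ n ∈ (Finset.Icc 1 N).filter (d ∣ ·), f n = ∑ m ∈ Finset.Icc 1 (N / d), f (d * m) := by
  symm
  refine Finset.sum_bij (fun m _ ↦ d * m) (fun m hm ↦ ?_) (fun m _ m' _ h ↦ ?_) (fun n hn ↦ ?_)
    (fun _ _ ↦ rfl)
  · obtain ⟨h1, h2⟩ := Finset.mem_Icc.mp hm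
    rw [Finset.mem_filter, Finset.mem_Icc]
    refine ⟨⟨Nat.mul_pos hd h1, ?_⟩, dvd_mul_right _ _⟩
    rw [mul_comm]
    exact (Nat.le_div_iff_mul_le hd).mp h2
  · exact Nat.eq_of_mul_eq_mul_left hd h
  · obtain ⟨h1, m, rfl⟩ := Finset.mem_filter.mp hn
    obtain ⟨h2, h3⟩ := Finset.mem_Icc.mp h1
    refine ⟨m, Finset.mem_Icc.mpr ⟨Nat.pos_of_mul_pos_left h2, ?_⟩, rfl⟩
    rw [Nat.le_div_iff_mul_le hd, mul_comm]
    exact h3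

/-- Möbius inversion for the indicator function of coprime pairs. -/
theorem sum_moebius_common_divisors {N u v : ℕ} (hv : v ∈ Finset.Icc 1 N) :
    ∑ d ∈ Finset.Icc 1 N, (if d ∣ v ∧ d ∣ u then (ArithmeticFunction.moebius d : ℂ) else 0) =
      if u.Coprime v then 1 else 0 := by
  obtain ⟨hv1, hvN⟩ := Finset.mem_Icc.mp hv
  have hg : u.gcd v ≠ 0 := (Nat.gcd_pos_of_pos_right _ hv1).ne'
  have hset : ((Finset.Icc 1 N).filter fun d ↦ d ∣ v ∧ d ∣ u) = (u.gcd v).divisors := by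
    ext d
    rw [Finset.mem_filter, Finset.mem_Icc, Nat.mem_divisors, Nat.dvd_gcd_iff]
    refine ⟨fun h ↦ ⟨⟨h.2.2, h.2.1⟩, hg⟩, fun h ↦ ⟨⟨?_, ?_⟩, h.1.2, h.1.1⟩⟩
    · exact Nat.pos_of_dvd_of_pos h.1.2 hv1
    · exact (Nat.le_of_dvd hv1 h.1.2).trans hvN
  have h := congrArg (fun f : ArithmeticFunction ℤ ↦ f (u.gcd v))
    ArithmeticFunction.moebius_mul_coe_zeta
  simp only [ArithmeticFunction.coe_mul_zeta_apply, ArithmeticFunction.one_apply] at h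
  rw [← Finset.sum_filter, hset, ← Int.cast_sum, h]
  simp [Nat.Coprime]

theorem sum_coprime_eq_sum_moebius_pairSum (p : ℕ) [Fact p.Prime] (a : ZMod p) (N : ℕ) :
    ∑ v ∈ Finset.Icc 1 N, ∑ u ∈ Finset.Icc 1 N, (if u.Coprime v ∧ ¬p ∣ v then
      ep p (a * ((u : ZMod p) * (v : ZMod p)⁻¹)) else 0) =
    ∑ d ∈ Finset.Icc 1 N, if p ∣ d then 0 else
      (ArithmeticFunction.moebius d : ℂ) * pairSum p a (N / d) := by
  set E : ℕ → ℕ → ℂ := fun v u ↦ if p ∣ v then 0 else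
    ep p ((u : ZMod p) * (a * (v : ZMod p)⁻¹)) with hE
  calc _ = ∑ v ∈ Finset.Icc 1 N, ∑ u ∈ Finset.Icc 1 N, ∑ d ∈ Finset.Icc 1 N,
        (if d ∣ v ∧ d ∣ u then (ArithmeticFunction.moebius d : ℂ) else 0) * E v u := by
        refine Finset.sum_congr rfl fun v hv ↦ Finset.sum_congr rfl fun u _ ↦ ?_
        rw [← Finset.sum_mul, sum_moebius_common_divisors hv, hE]
        rw [mul_left_comm a]
        by_cases h1 : u.Coprime v <;> by_cases h2 : p ∣ v <;> simp [h1, h2]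
    _ = ∑ d ∈ Finset.Icc 1 N, ∑ v ∈ Finset.Icc 1 N, ∑ u ∈ Finset.Icc 1 N,
        (if d ∣ v ∧ d ∣ u then (ArithmeticFunction.moebius d : ℂ) else 0) * E v u := by
        rw [Finset.sum_comm]
        rw [Finset.sum_congr rfl fun v _ ↦ Finset.sum_comm, Finset.sum_comm]
        exact Finset.sum_congr rfl fun d _ ↦ Finset.sum_comm
    _ = ∑ d ∈ Finset.Icc 1 N, (ArithmeticFunction.moebius d : ℂ) *
        ∑ v ∈ (Finset.Icc 1 N).filter (d ∣ ·), ∑ u ∈ (Finset.Icc 1 N).filter (d ∣ ·), E v u := by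
        refine Finset.sum_congr rfl fun d _ ↦ ?_
        rw [Finset.sum_filter, Finset.mul_sum]
        refine Finset.sum_congr rfl fun v _ ↦ ?_
        by_cases hdv : d ∣ v
        · rw [if_pos hdv, Finset.sum_filter, Finset.mul_sum]
          refine Finset.sum_congr rfl fun u _ ↦ ?_
          simp [hdv]
        · simp [hdv]
    _ = _ := by
        refine Finset.sum_congr rfl fun d hd ↦ ?_
        have hd0 : 0 < d := (Finset.mem_Icc.mp hd).1
        rw [sum_Icc_filter_dvd N d hd0]
        by_cases hpd : p ∣ d
        · rw [if_pos hpd]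
          simp [hE, hpd.mul_right]
        · rw [if_neg hpd, pairSum]
          congr 1
          have hdp : (d : ZMod p) ≠ 0 := by rwa [Ne, ZMod.natCast_eq_zero_iff]
          refine Finset.sum_congr rfl fun v _ ↦ ?_
          rw [sum_Icc_filter_dvd N d hd0]
          have hiff : p ∣ d * v ↔ p ∣ v :=
            ⟨fun h ↦ ((Fact.out : p.Prime).dvd_mul.mp h).resolve_left hpd, fun h ↦ h.mul_left d⟩
          by_cases hpv : p ∣ v
          · simp [hE, hiff, hpv]
          · simp only [hE, hiff, hpv, if_false]
            refine Finset.sum_congr rfl fun u _ ↦ ?_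
            congr 1
            push_cast
            have hvp : (v : ZMod p) ≠ 0 := by rwa [Ne, ZMod.natCast_eq_zero_iff]
            field_simp

/-- The sum over Farey fractions as a sum over coprime pairs. -/
theorem sum_FT_eq_sum_coprime (p : ℕ) (T : ℝ) (hT : 1 ≤ T) (a : ZMod p) :
    ∑ q ∈ (FT T).filter fun q => ¬(p ∣ q.den), ep p (a * redQ p q) =
      ∑ v ∈ Finset.Icc 1 ⌊T⌋₊, ∑ u ∈ Finset.Icc 1 ⌊T⌋₊, (if u.Coprime v ∧ ¬p ∣ v then
        ep p (a * ((u : ZMod p) * (v : ZMod p)⁻¹)) else 0) := by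
  have hfloor : ⌊T⌋ = (⌊T⌋₊ : ℤ) := (Int.natCast_floor_eq_floor (by linarith)).symm
  have hnum : ∀ {u v : ℕ}, 0 < v → u.Coprime v → ((u : ℚ) / v).num = u := fun {u v} hv h ↦ by
    simpa only [Int.cast_natCast] using
      Rat.num_div_eq_of_coprime (a := u) (b := v) (by exact_mod_cast hv) (by simpa)
  have hden : ∀ {u v : ℕ}, 0 < v → u.Coprime v → ((u : ℚ) / v).den = v := fun {u v} hv h ↦ by
    have := Rat.den_div_eq_of_coprime (a := u) (b := v) (by exact_mod_cast hv) (by simpa)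
    simpa only [Int.cast_natCast, Nat.cast_inj] using this
  rw [← Finset.sum_product', ← Finset.sum_filter]
  symm
  refine Finset.sum_bij (fun w _ ↦ (w.2 : ℚ) / (w.1 : ℚ)) ?_ ?_ ?_ ?_
  · rintro ⟨v, u⟩ hw
    simp only [Finset.mem_filter, Finset.mem_product, Finset.mem_Icc] at hw
    obtain ⟨⟨⟨hv1, hv2⟩, hu1, hu2⟩, hc, hp⟩ := hw
    rw [Finset.mem_filter, hden hv1 hc]
    refine ⟨?_, hp⟩
    rw [FT, hfloor, Finset.mem_image]
    refine ⟨((u : ℤ), (v : ℤ)), ?_, by simp⟩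
    simp only [Finset.mem_filter, Finset.mem_product, Finset.mem_Icc, Int.gcd_natCast_natCast]
    exact ⟨⟨⟨by omega, by omega⟩, by omega, by omega⟩, hc⟩
  · rintro ⟨v, u⟩ hw ⟨v', u'⟩ hw' h
    simp only [Finset.mem_filter, Finset.mem_product, Finset.mem_Icc] at hw hw' h
    have h1 := congrArg Rat.num h
    have h2 := congrArg Rat.den h
    rw [hnum hw.1.1.1 hw.2.1, hnum hw'.1.1.1 hw'.2.1] at h1
    rw [hden hw.1.1.1 hw.2.1, hden hw'.1.1.1 hw'.2.1] at h2
    rw [Prod.mk.injEq]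
    exact ⟨h2, by exact_mod_cast h1⟩
  · intro q hq
    rw [Finset.mem_filter, FT, hfloor, Finset.mem_image] at hq
    obtain ⟨⟨⟨u, v⟩, hw, rfl⟩, hp⟩ := hq
    simp only [Finset.mem_filter, Finset.mem_product, Finset.mem_Icc] at hw
    obtain ⟨⟨⟨hu1, hu2⟩, hv1, hv2⟩, hc⟩ := hw
    lift u to ℕ using by omega
    lift v to ℕ using by omega
    simp only [Int.cast_natCast, Int.gcd_natCast_natCast] at hp hc ⊢
    rw [hden (by omega) hc] at hp
    refine ⟨(v, u), ?_, rfl⟩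
    simp only [Finset.mem_filter, Finset.mem_product, Finset.mem_Icc]
    exact ⟨⟨⟨by omega, by omega⟩, by omega, by omega⟩, hc, hp⟩
  · rintro ⟨v, u⟩ hw
    simp only [Finset.mem_filter, Finset.mem_product, Finset.mem_Icc] at hw
    rw [redQ, hnum hw.1.1.1 hw.2.1, hden hw.1.1.1 hw.2.1, Int.cast_natCast]

/-- Lemma 2.5: bound on exponential sums over Farey fractions. -/
theorem expsum_FT_bound (ε : ℝ) (hε : 0 < ε) :
    ∃ C : ℝ, 0 < C ∧ ∀ p : ℕ, p.Prime → ∀ T : ℝ, 1 ≤ T → ∀ a : ZMod p, a ≠ 0 →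
      ‖∑ q ∈ (FT T).filter fun q => ¬(p ∣ q.den), ep p (a * redQ p q)‖ ≤
        C * T * (T * p) ^ ε := by
  obtain ⟨C₁, hC₁, hpair⟩ := exists_norm_pairSum_le (ε / 2) (by positivity)
  obtain ⟨C₂, hC₂, hharm⟩ := exists_sum_inv_le_rpow (ε / 2) (by positivity)
  refine ⟨C₁ * C₂, by positivity, fun p hp T hT a ha ↦ ?_⟩
  have : Fact p.Prime := ⟨hp⟩
  have hp1 : (1 : ℝ) ≤ p := by exact_mod_cast hp.one_le
  have hT0 : 0 ≤ T := by linarith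
  have hN1 : 1 ≤ ⌊T⌋₊ := Nat.le_floor (by simpa using hT)
  have hNT : (⌊T⌋₊ : ℝ) ≤ T := Nat.floor_le hT0
  rw [sum_FT_eq_sum_coprime p T hT, sum_coprime_eq_sum_moebius_pairSum]
  have hterm : ∀ d ∈ Finset.Icc 1 ⌊T⌋₊, ‖(if p ∣ d then 0 else
      (ArithmeticFunction.moebius d : ℂ) * pairSum p a (⌊T⌋₊ / d) : ℂ)‖ ≤
      C₁ * T * (T * p) ^ (ε / 2) * (d : ℝ)⁻¹ := by
    intro d hd
    obtain ⟨hd1, hdN⟩ := Finset.mem_Icc.mp hd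
    have hd1' : (1 : ℝ) ≤ d := by exact_mod_cast hd1
    split_ifs
    · rw [norm_zero]; positivity
    · have hle : ((⌊T⌋₊ / d : ℕ) : ℝ) ≤ T * (d : ℝ)⁻¹ :=
        Nat.cast_div_le.trans (by rw [div_eq_mul_inv]; gcongr)
      have hle' : ((⌊T⌋₊ / d : ℕ) : ℝ) ≤ T :=
        le_trans (by exact_mod_cast Nat.div_le_self _ _) hNT
      have hmu : ‖(ArithmeticFunction.moebius d : ℂ)‖ ≤ 1 := by
        rw [Complex.norm_intCast]
        exact_mod_cast ArithmeticFunction.abs_moebius_le_one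
      calc _ ≤ 1 * ‖pairSum p a (⌊T⌋₊ / d)‖ := by rw [norm_mul]; gcongr
        _ = ‖pairSum p a (⌊T⌋₊ / d)‖ := one_mul _
        _ ≤ C₁ * (⌊T⌋₊ / d : ℕ) * ((p : ℝ) * (⌊T⌋₊ / d : ℕ)) ^ (ε / 2) :=
            hpair p hp a ha _ (Nat.div_pos hdN hd1)
        _ ≤ C₁ * (T * (d : ℝ)⁻¹) * ((p : ℝ) * T) ^ (ε / 2) := by gcongr
        _ = _ := by rw [mul_comm (p : ℝ)]; ring
  calc _ ≤ ∑ d ∈ Finset.Icc 1 ⌊T⌋₊, C₁ * T * (T * p) ^ (ε / 2) * (d : ℝ)⁻¹ :=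
        norm_sum_le_of_le _ hterm
    _ = C₁ * T * (T * p) ^ (ε / 2) * ∑ d ∈ Finset.Icc 1 ⌊T⌋₊, (d : ℝ)⁻¹ := by
        rw [Finset.mul_sum]
    _ ≤ C₁ * T * (T * p) ^ (ε / 2) * (C₂ * (⌊T⌋₊ : ℝ) ^ (ε / 2)) := by
        gcongr
        exact hharm _ hN1
    _ ≤ C₁ * T * (T * p) ^ (ε / 2) * (C₂ * (T * p) ^ (ε / 2)) := by
        gcongr
        nlinarith
    _ = C₁ * C₂ * T * ((T * p) ^ (ε / 2) * (T * p) ^ (ε / 2)) := by ring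
    _ = _ := by rw [← Real.rpow_add (by positivity), add_halves]
end
end

section
/- There is an absolute constant C with the following property: for every positive integer m, every finite list w₁, …, w_m of (not necessarily distinct) real numbers in [−1, 1], and every positive integer k, one has max_{−1 ≤ a < b ≤ 1} | A([a,b]; m) − m·G(a,b) | ≤ C ( m/k + Σ_{n=1}^{k} (1/n) | Σ_{i=1}^{m} U_n(w_i) | ), where A([a,b]; m) = #{ i : 1 ≤ i ≤ m, w_i ∈ [a,b] }. -/
open Polynomial Finset

attribute [local instance 10] Classical.propDecidable

noncomputable section

section Discrepancy

open Real intervalIntegral MeasureTheory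

/-- The Fejér kernel of order `k`. -/
def fejer (k : ℕ) (t : ℝ) : ℝ := 1 + 2 * ∑ d ∈ Finset.Icc 1 k, (1 - (d : ℝ) / k) * cos (d * t)

lemma two_mul_sin_half_mul_dirichlet (k : ℕ) (t : ℝ) :
    2 * sin (t / 2) * (1 + 2 * ∑ d ∈ Finset.Icc 1 k, cos (d * t)) =
      2 * sin ((k + 1 / 2) * t) := by
  induction k with
  | zero => simp; ring_nf
  | succ k ih =>
    rw [Finset.sum_Icc_succ_top (by omega), mul_add 2, ← add_assoc, mul_add, ih]
    have h1 : ((k : ℝ) + 1 / 2) * t = ((k + 1 : ℕ) : ℝ) * t - t / 2 := by push_cast; ring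
    have h2 : (((k + 1 : ℕ) : ℝ) + 1 / 2) * t = ((k + 1 : ℕ) : ℝ) * t + t / 2 := by ring
    rw [h1, h2, sin_sub, sin_add]
    ring

lemma sin_sq_mul_fejer_aux (k : ℕ) (t : ℝ) :
    2 * sin (t / 2) ^ 2 * (k + 2 * ∑ d ∈ Finset.Icc 1 k, ((k : ℝ) - d) * cos (d * t)) =
      1 - cos (k * t) := by
  induction k with
  | zero => simp
  | succ k ih =>
    have hstep : ((k + 1 : ℕ) : ℝ) + 2 * ∑ d ∈ Finset.Icc 1 (k + 1),
        (((k + 1 : ℕ) : ℝ) - d) * cos (d * t) =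
        (k + 2 * ∑ d ∈ Finset.Icc 1 k, ((k : ℝ) - d) * cos (d * t)) +
          (1 + 2 * ∑ d ∈ Finset.Icc 1 k, cos (d * t)) := by
      rw [Finset.sum_Icc_succ_top (by omega), sub_self, zero_mul, add_zero]
      have : ∀ d ∈ Finset.Icc 1 k, (((k + 1 : ℕ) : ℝ) - d) * cos (d * t) =
          ((k : ℝ) - d) * cos (d * t) + cos (d * t) := fun d _ => by push_cast; ring
      rw [Finset.sum_congr rfl this, Finset.sum_add_distrib]
      push_cast
      ring
    have hd := two_mul_sin_half_mul_dirichlet k t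
    rw [hstep, mul_add, ih]
    have h1 : (k : ℝ) * t = ((k : ℝ) + 1 / 2) * t - t / 2 := by ring
    have h2 : ((k + 1 : ℕ) : ℝ) * t = ((k : ℝ) + 1 / 2) * t + t / 2 := by push_cast; ring
    rw [h1, h2, cos_sub, cos_add]
    linear_combination sin (t / 2) * hd

lemma sin_sq_mul_fejer {k : ℕ} (hk : 0 < k) (t : ℝ) :
    2 * sin (t / 2) ^ 2 * (k * fejer k t) = 1 - cos (k * t) := by
  have hk' : (k : ℝ) ≠ 0 := by positivity
  rw [← sin_sq_mul_fejer_aux, fejer, mul_add, mul_one, mul_left_comm, Finset.mul_sum]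
  have : ∀ d ∈ Finset.Icc 1 k, (k : ℝ) * ((1 - (d : ℝ) / k) * cos (d * t)) =
      ((k : ℝ) - d) * cos (d * t) := fun d _ => by field_simp
  rw [Finset.sum_congr rfl this]

lemma continuous_fejer (k : ℕ) : Continuous (fejer k) := by
  unfold fejer; fun_prop

lemma fejer_nonneg {k : ℕ} (hk : 0 < k) (t : ℝ) : 0 ≤ fejer k t := by
  have hk' : (0 : ℝ) < k := by positivity
  by_cases hs : sin (t / 2) = 0
  · obtain ⟨n, hn⟩ := sin_eq_zero_iff.1 hs
    have ht : t = n * (2 * π) := by linarith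
    have hc : ∀ d : ℕ, cos (d * t) = 1 := fun d => by
      rw [ht, ← mul_assoc]
      exact_mod_cast cos_int_mul_two_pi (d * n)
    simp only [fejer, hc, mul_one]
    have : 0 ≤ ∑ d ∈ Finset.Icc 1 k, (1 - (d : ℝ) / k) :=
      Finset.sum_nonneg fun d hd => by
        rw [sub_nonneg, div_le_one hk']
        exact_mod_cast (Finset.mem_Icc.1 hd).2
    linarith
  · have h := sin_sq_mul_fejer hk t
    have hs' : 0 < 2 * sin (t / 2) ^ 2 := by positivity
    have h1 := cos_le_one (k * t)
    have h2 : 0 ≤ k * fejer k t := by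
      by_contra! hneg
      nlinarith
    exact nonneg_of_mul_nonneg_right h2 hk'

lemma fejer_mul_sq_le {k : ℕ} (hk : 0 < k) {t : ℝ} (ht : |t| ≤ π) :
    fejer k t * t ^ 2 ≤ π ^ 2 / k := by
  have hk' : (0 : ℝ) < k := by positivity
  have h := sin_sq_mul_fejer hk t
  have hb : 2 / π * |t / 2| ≤ |sin (t / 2)| := mul_abs_le_abs_sin (by
    rw [abs_div, abs_two]; linarith)
  have hsq : t ^ 2 / π ^ 2 ≤ sin (t / 2) ^ 2 := by
    rw [← sq_abs (sin (t / 2))]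
    calc t ^ 2 / π ^ 2 = (2 / π * |t / 2|) ^ 2 := by
          rw [mul_pow, sq_abs]; ring
      _ ≤ _ := by gcongr
  have hF := fejer_nonneg hk t
  rw [le_div_iff₀ hk']
  rw [div_le_iff₀ (by positivity)] at hsq
  have h1 := neg_one_le_cos (k * t)
  have h3 : sin (t / 2) ^ 2 * (k * fejer k t) ≤ 1 := by linarith
  calc fejer k t * t ^ 2 * k = (k * fejer k t) * t ^ 2 := by ring
    _ ≤ (k * fejer k t) * (sin (t / 2) ^ 2 * π ^ 2) := by gcongr
    _ = (sin (t / 2) ^ 2 * (k * fejer k t)) * π ^ 2 := by ring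
    _ ≤ 1 * π ^ 2 := by gcongr
    _ = π ^ 2 := one_mul _

lemma integral_cos_nat_mul {d : ℕ} (hd : d ≠ 0) : ∫ t in (-π)..π, cos (d * t) = 0 := by
  have hd' : (d : ℝ) ≠ 0 := by exact_mod_cast hd
  rw [integral_comp_mul_left (fun x => cos x) hd', integral_cos]
  simp [sin_nat_mul_pi]

lemma integral_mul_fejer {f : ℝ → ℝ} (hf : IntervalIntegrable f volume (-π) π) (k : ℕ) :
    ∫ t in (-π)..π, f t * fejer k t = (∫ t in (-π)..π, f t) +
      2 * ∑ d ∈ Finset.Icc 1 k, (1 - (d : ℝ) / k) * ∫ t in (-π)..π, f t * cos (d * t) := by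
  have hc : ∀ d : ℕ, IntervalIntegrable (fun t => f t * cos (d * t)) volume (-π) π := fun d =>
    hf.mul_continuousOn (by fun_prop)
  have : ∀ t, f t * fejer k t = f t + 2 * ∑ d ∈ Finset.Icc 1 k,
      (1 - (d : ℝ) / k) * (f t * cos (d * t)) := fun t => by
    rw [fejer, mul_add, mul_one, mul_left_comm, Finset.mul_sum]
    congr 2
    exact Finset.sum_congr rfl fun d _ => by ring
  simp only [this]
  rw [integral_add hf, intervalIntegral.integral_const_mul,
    intervalIntegral.integral_finsetSum]
  · simp only [intervalIntegral.integral_const_mul]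
  · exact fun d _ => (hc d).const_mul _
  · have := IntervalIntegrable.sum (Finset.Icc 1 k) (f := fun (d : ℕ) t =>
      (1 - (d : ℝ) / k) * (f t * cos (d * t))) fun d _ => (hc d).const_mul _
    have := this.const_mul 2
    simpa only [Finset.sum_apply] using this

lemma integral_fejer (k : ℕ) : ∫ t in (-π)..π, fejer k t = 2 * π := by
  have h := integral_mul_fejer (f := fun _ => 1) intervalIntegrable_const k
  simp only [one_mul] at h
  rw [h, Finset.sum_eq_zero fun d hd => by
    rw [integral_cos_nat_mul (by have := Finset.mem_Icc.1 hd; omega), mul_zero]]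
  simp
  ring

lemma integral_inv_sq_add_sq_le {η : ℝ} (hη : 0 < η) (a b : ℝ) :
    ∫ t in a..b, (η ^ 2 + t ^ 2)⁻¹ ≤ π / η := by
  have hpos : ∀ t : ℝ, η ^ 2 + t ^ 2 ≠ 0 := fun t => by positivity
  have hd : ∀ t ∈ Set.uIcc a b,
      HasDerivAt (fun t => η⁻¹ * arctan (t / η)) ((η ^ 2 + t ^ 2)⁻¹) t := fun t _ => by
    have := (((hasDerivAt_id t).div_const η).arctan).const_mul η⁻¹
    refine this.congr_deriv ?_
    have := hpos t
    simp only [id]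
    field_simp
  rw [integral_eq_sub_of_hasDerivAt hd]
  · have h1 := arctan_lt_pi_div_two (b / η)
    have h2 := neg_pi_div_two_lt_arctan (a / η)
    rw [← mul_sub, div_eq_inv_mul π]
    gcongr
    linarith
  · exact Continuous.intervalIntegrable (Continuous.inv₀ (by fun_prop) hpos) _ _

/-- A bounded function whose downward variation is controlled is bounded by its Fejér means, up to
a multiple of the Lipschitz constant and half of the trivial bound. -/
lemma le_of_integral_mul_fejer_le {f : ℝ → ℝ} {D L E : ℝ} {k : ℕ} (hk : 0 < k)
    (hint : ∀ c, IntervalIntegrable (fun t => f (c + t)) volume (-π) π)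
    (hD : ∀ x, |f x| ≤ D) (hL : 0 ≤ L) (hmono : ∀ x y, x ≤ y → f x - L * (y - x) ≤ f y)
    (hE : ∀ c, ∫ t in (-π)..π, f (c + t) * fejer k t ≤ 2 * π * E) (x : ℝ) :
    f x ≤ E + 8 * π ^ 2 * L / k + D / 2 := by
  have hk' : (0 : ℝ) < k := by positivity
  have hD0 : 0 ≤ D := (abs_nonneg _).trans (hD 0)
  have hπ := pi_pos
  set η : ℝ := 4 * π ^ 2 / k with hη
  have hη0 : 0 < η := by positivity
  have key : ∀ t ∈ Set.Icc (-π) π,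
      (f x - 2 * L * η) * fejer k t - 4 * D * π ^ 2 / k * (η ^ 2 + t ^ 2)⁻¹ ≤
        f (x + η + t) * fejer k t := by
    intro t ht
    have hF := fejer_nonneg hk t
    rcases le_or_gt |t| η with h | h
    · have h1 := abs_le.1 h
      have h2 := hmono x (x + η + t) (by linarith)
      have h3 : f x - 2 * L * η ≤ f (x + η + t) := by nlinarith
      have h4 : 0 ≤ 4 * D * π ^ 2 / k * (η ^ 2 + t ^ 2)⁻¹ := by positivity
      nlinarith
    · have h1 := fejer_mul_sq_le hk (abs_le.2 ht)
      have h2 : η ^ 2 ≤ t ^ 2 := by rw [← sq_abs t]; gcongr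
      have h3 : fejer k t ≤ 2 * (π ^ 2 / k) * (η ^ 2 + t ^ 2)⁻¹ := by
        rw [← div_eq_mul_inv, le_div_iff₀ (by positivity)]
        nlinarith
      have h4 := (abs_le.1 (hD (x + η + t))).1
      have h5 := (abs_le.1 (hD x)).2
      have h6 : 0 ≤ L * η := by positivity
      have h7 : (f x - 2 * L * η) * fejer k t ≤ (f (x + η + t) + 2 * D) * fejer k t := by
        gcongr; linarith
      have h8 : 2 * D * fejer k t ≤ 2 * D * (2 * (π ^ 2 / k) * (η ^ 2 + t ^ 2)⁻¹) := by gcongr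
      have h9 : 2 * D * (2 * (π ^ 2 / k) * (η ^ 2 + t ^ 2)⁻¹) =
        4 * D * π ^ 2 / k * (η ^ 2 + t ^ 2)⁻¹ := by ring
      linarith
  have hci : IntervalIntegrable (fun t : ℝ => 4 * D * π ^ 2 / k * (η ^ 2 + t ^ 2)⁻¹)
      volume (-π) π :=
    (Continuous.intervalIntegrable (Continuous.inv₀ (by fun_prop)
      fun t => by positivity) _ _).const_mul _
  have hfi : IntervalIntegrable (fun t : ℝ => (f x - 2 * L * η) * fejer k t) volume (-π) π :=
    ((continuous_fejer k).intervalIntegrable _ _).const_mul _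
  have hmain := (integral_mono_on (by linarith) (hfi.sub hci)
    ((hint (x + η)).mul_continuousOn (continuous_fejer k).continuousOn) key).trans (hE (x + η))
  rw [integral_sub hfi hci, intervalIntegral.integral_const_mul,
    intervalIntegral.integral_const_mul, integral_fejer] at hmain
  have htail : 4 * D * π ^ 2 / k * ∫ t in (-π)..π, (η ^ 2 + t ^ 2)⁻¹ ≤
      4 * D * π ^ 2 / k * (π / η) := by
    gcongr
    exact integral_inv_sq_add_sq_le hη0 _ _
  have heq : 4 * D * π ^ 2 / k * (π / η) = 2 * π * (D / 2) := by
    rw [hη]; field_simp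
  have h1 : 2 * π * (f x - 2 * L * η) ≤ 2 * π * (E + D / 2) := by linarith
  have h2 := le_of_mul_le_mul_left h1 (by positivity)
  have h3 : 2 * L * η = 8 * π ^ 2 * L / k := by rw [hη]; ring
  linarith

/-- The sawtooth function of period `2π`. -/
def saw (x : ℝ) : ℝ := 1 / 2 - Int.fract (x / (2 * π))

lemma saw_periodic : Function.Periodic saw (2 * π) := fun x => by
  have : (x + 2 * π) / (2 * π) = x / (2 * π) + 1 := by
    have := pi_pos.ne'
    field_simp
  rw [saw, this, Int.fract_add_one, saw]

lemma abs_saw_le (x : ℝ) : |saw x| ≤ 1 / 2 := by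
  have h1 := Int.fract_nonneg (x / (2 * π))
  have h2 := (Int.fract_lt_one (x / (2 * π))).le
  rw [saw, abs_le]
  constructor <;> linarith

lemma intervalIntegrable_saw (a b : ℝ) : IntervalIntegrable saw volume a b := by
  have : saw = fun x => (1 / 2 - x / (2 * π)) + (⌊x / (2 * π)⌋ : ℝ) := by
    ext x; rw [saw, Int.fract]; ring
  rw [this]
  refine IntervalIntegrable.add (Continuous.intervalIntegrable (by fun_prop) _ _)
    (Monotone.intervalIntegrable fun x y hxy => ?_)
  have hπ := pi_pos
  have : x / (2 * π) ≤ y / (2 * π) := by gcongr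
  exact_mod_cast Int.floor_mono this

lemma saw_sub_le {x y : ℝ} (hxy : x ≤ y) : saw x - (y - x) / (2 * π) ≤ saw y := by
  have hπ := pi_pos
  have h1 : x / (2 * π) ≤ y / (2 * π) := by gcongr
  have h2 : (⌊x / (2 * π)⌋ : ℝ) ≤ ⌊y / (2 * π)⌋ := by exact_mod_cast Int.floor_mono h1
  rw [saw, saw, Int.fract, Int.fract, sub_div]
  linarith

lemma saw_of_mem_Ico {x : ℝ} (h0 : 0 ≤ x) (h1 : x < 2 * π) : saw x = 1 / 2 - x / (2 * π) := by
  have hπ := pi_pos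
  rw [saw, Int.fract_eq_self.2 ⟨by positivity, (div_lt_one (by positivity)).2 h1⟩]

lemma integral_saw_mul_cos_eq (u : ℝ) (d : ℕ) :
    ∫ t in (-π)..π, saw (u + t) * cos (d * t) =
      ∫ y in (0 : ℝ)..(2 * π), (1 / 2 - y / (2 * π)) * cos (d * (y - u)) := by
  have h1 : ∀ t, saw (u + t) * cos (d * t) =
      (fun y => saw y * cos (d * (y - u))) (u + t) := fun t => by
    simp
  have hper : Function.Periodic (fun y => saw y * cos (d * (y - u))) (2 * π) := fun y => by
    have : (d : ℝ) * (y + 2 * π - u) = d * (y - u) + d * (2 * π) := by ring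
    simp only [saw_periodic y, this, cos_add_nat_mul_two_pi]
  simp only [h1]
  rw [integral_comp_add_left (fun y => saw y * cos (d * (y - u)))]
  have h2 : u + π = u + -π + 2 * π := by ring
  rw [h2, hper.intervalIntegral_add_eq (u + -π) 0, zero_add]
  refine integral_congr_Ioo_of_le (by positivity) fun y hy => ?_
  simp only [saw_of_mem_Ico hy.1.le hy.2]

lemma integral_saw (u : ℝ) : ∫ t in (-π)..π, saw (u + t) = 0 := by
  have h := integral_saw_mul_cos_eq u 0
  simp only [Nat.cast_zero, zero_mul, cos_zero, mul_one] at h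
  have hπ := pi_pos.ne'
  rw [h, integral_sub intervalIntegrable_const (Continuous.intervalIntegrable (by fun_prop) _ _),
    intervalIntegral.integral_div (2 * π), integral_id]
  simp
  field_simp
  ring

lemma integral_saw_mul_cos (u : ℝ) {d : ℕ} (hd : d ≠ 0) :
    ∫ t in (-π)..π, saw (u + t) * cos (d * t) = sin (d * u) / d := by
  have hd' : (d : ℝ) ≠ 0 := by exact_mod_cast hd
  have hπ := pi_pos.ne'
  have hder : ∀ y ∈ Set.uIcc 0 (2 * π), HasDerivAt
      (fun y => (1 / 2 - y / (2 * π)) * (sin (d * (y - u)) / d) -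
        cos (d * (y - u)) / (2 * π * d ^ 2))
      ((1 / 2 - y / (2 * π)) * cos (d * (y - u))) y := fun y _ => by
    have hlin : HasDerivAt (fun y : ℝ => d * (y - u)) d y := by
      simpa using ((hasDerivAt_id y).sub_const u).const_mul (d : ℝ)
    have := ((((hasDerivAt_id y).div_const (2 * π)).const_sub (1 / 2)).mul
      (hlin.sin.div_const (d : ℝ))).sub (hlin.cos.div_const (2 * π * d ^ 2))
    refine this.congr_deriv ?_
    simp only [id]
    field_simp
    ring
  rw [integral_saw_mul_cos_eq, integral_eq_sub_of_hasDerivAt hder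
    (Continuous.intervalIntegrable (by fun_prop) _ _)]
  have h1 : (d : ℝ) * (2 * π - u) = d * (2 * π) - d * u := by ring
  have h2 : (d : ℝ) * (0 - u) = -(d * u) := by ring
  rw [h1, h2, sin_neg, cos_neg, sin_nat_mul_two_pi_sub, cos_nat_mul_two_pi_sub]
  field_simp
  ring

lemma abs_le_of_abs_integral_mul_fejer_le {f : ℝ → ℝ} {D L E : ℝ} {k : ℕ} (hk : 0 < k)
    (hint : ∀ a b, IntervalIntegrable f volume a b)
    (hD : ∀ x, |f x| ≤ D) (hL : 0 ≤ L) (hmono : ∀ x y, x ≤ y → f x - L * (y - x) ≤ f y)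
    (hE : ∀ c, |∫ t in (-π)..π, f (c + t) * fejer k t| ≤ 2 * π * E) (x : ℝ) :
    |f x| ≤ 2 * (E + 8 * π ^ 2 * L / k) := by
  have hbdd : BddAbove (Set.range fun x => |f x|) := ⟨D, by rintro _ ⟨x, rfl⟩; exact hD x⟩
  have hsup : ∀ x, |f x| ≤ ⨆ x, |f x| := fun x => le_ciSup hbdd x
  have hupper := le_of_integral_mul_fejer_le hk
    (fun c => by simpa using (hint (c + -π) (c + π)).comp_add_left c) hsup hL hmono
    fun c => (abs_le.1 (hE c)).2
  have hlower := le_of_integral_mul_fejer_le (f := fun x => -f (-x)) (E := E) hk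
    (fun c => by
      have h := ((hint (-c - π) (-c + π)).comp_sub_left (-c)).neg.symm
      convert h using 1
      · ext t; simp [sub_eq_add_neg, add_comm]
      · ring
      · ring)
    (fun x => by simpa using hsup (-x)) hL
    (fun x y hxy => by
      have := hmono (-y) (-x) (by linarith)
      linarith)
    (fun c => by
      have h1 : ∀ t, -f (-(c + t)) * fejer k t =
          (fun s => -(f (-c + s) * fejer k s)) (-t) := fun t => by
        have : fejer k (-t) = fejer k t := by simp [fejer]
        simp only [this, neg_add]
        ring
      simp only [h1]
      rw [integral_comp_neg (fun s => -(f (-c + s) * fejer k s)), neg_neg,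
        intervalIntegral.integral_neg]
      linarith [(abs_le.1 (hE (-c))).1])
  have hfin : (⨆ x, |f x|) ≤ E + 8 * π ^ 2 * L / k + (⨆ x, |f x|) / 2 :=
    ciSup_le fun x => abs_le'.2 ⟨hupper x, by simpa using hlower (-x)⟩
  linarith [hsup x]

lemma integral_sin_add_int_mul (u : ℝ) (n : ℤ) :
    ∫ t in (-π)..π, sin (u + n * t) = if n = 0 then 2 * π * sin u else 0 := by
  split_ifs with h
  · simp only [h, Int.cast_zero, zero_mul, add_zero, intervalIntegral.integral_const,
      smul_eq_mul]
    ring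
  · have hn : (n : ℝ) ≠ 0 := by exact_mod_cast h
    have hder : ∀ t ∈ Set.uIcc (-π) π, HasDerivAt (fun t => -(cos (u + n * t) / n))
        (sin (u + n * t)) t := fun t _ => by
      have hlin : HasDerivAt (fun t : ℝ => u + n * t) n t := by
        simpa using ((hasDerivAt_id t).const_mul (n : ℝ)).const_add u
      refine (hlin.cos.div_const (n : ℝ)).neg.congr_deriv ?_
      field_simp
    rw [integral_eq_sub_of_hasDerivAt hder (Continuous.intervalIntegrable (by fun_prop) _ _)]
    have : u + n * π = u + n * -π + n * (2 * π) := by ring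
    rw [this, cos_add_int_mul_two_pi]
    ring

lemma integral_sin_two_mul_mul_cos (c : ℝ) (d : ℕ) :
    ∫ t in (-π)..π, sin (2 * (c + t)) * cos (d * t) =
      if d = 2 then π * sin (2 * c) else 0 := by
  have h : ∀ t, sin (2 * (c + t)) * cos (d * t) =
      1 / 2 * (sin (2 * c + ((2 + d : ℤ) : ℝ) * t) + sin (2 * c + ((2 - d : ℤ) : ℝ) * t)) := by
    intro t
    have h1 : 2 * c + ((2 + d : ℤ) : ℝ) * t = 2 * (c + t) + d * t := by push_cast; ring
    have h2 : 2 * c + ((2 - d : ℤ) : ℝ) * t = 2 * (c + t) - d * t := by push_cast; ring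
    rw [h1, h2, sin_add (2 * (c + t)), sin_sub (2 * (c + t))]
    ring
  simp only [h]
  rw [intervalIntegral.integral_const_mul, integral_add
    (Continuous.intervalIntegrable (by fun_prop) _ _)
    (Continuous.intervalIntegrable (by fun_prop) _ _),
    integral_sin_add_int_mul, integral_sin_add_int_mul, if_neg (by omega)]
  by_cases hd : d = 2
  · rw [if_pos hd, if_pos (by omega)]; ring
  · rw [if_neg hd, if_neg (by omega)]; ring

/-- The odd, `2π`-periodic extension of the difference between the indicator of `[θ, π]` and the
distribution function of the Sato–Tate measure on `[0, π]`. -/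
def angleDiscrepancy (θ x : ℝ) : ℝ := saw (x - θ) + saw (x + θ) + sin (2 * x) / (2 * π)

/-- The distribution function of the Sato–Tate measure on `[0, π]`. -/
def satoTateCDF (x : ℝ) : ℝ := (x - sin (2 * x) / 2) / π

lemma intervalIntegrable_angleDiscrepancy (θ a b : ℝ) :
    IntervalIntegrable (angleDiscrepancy θ) volume a b := by
  refine IntervalIntegrable.add (IntervalIntegrable.add ?_ ?_)
    (Continuous.intervalIntegrable (by fun_prop) _ _)
  · simpa using (intervalIntegrable_saw (a - θ) (b - θ)).comp_sub_right θ
  · simpa using (intervalIntegrable_saw (a + θ) (b + θ)).comp_add_right θ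

lemma abs_angleDiscrepancy_le (θ x : ℝ) : |angleDiscrepancy θ x| ≤ 2 := by
  have h1 := abs_saw_le (x - θ)
  have h2 := abs_saw_le (x + θ)
  have h3 : |sin (2 * x) / (2 * π)| ≤ 1 := by
    rw [abs_div, abs_of_pos two_pi_pos, div_le_one two_pi_pos]
    linarith [abs_sin_le_one (2 * x), two_le_pi]
  rw [angleDiscrepancy]
  linarith [abs_add_le (saw (x - θ) + saw (x + θ)) (sin (2 * x) / (2 * π)),
    abs_add_le (saw (x - θ)) (saw (x + θ))]

lemma angleDiscrepancy_sub_le (θ : ℝ) {x y : ℝ} (hxy : x ≤ y) :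
    angleDiscrepancy θ x - 2 / π * (y - x) ≤ angleDiscrepancy θ y := by
  have hπ := pi_pos
  have h1 := saw_sub_le (x := x - θ) (y := y - θ) (by linarith)
  have h2 := saw_sub_le (x := x + θ) (y := y + θ) (by linarith)
  have h3 : sin (2 * x) - sin (2 * y) ≤ 2 * (y - x) := by
    have h : 2 * x - 2 * y ≤ 0 := by linarith
    have := (le_abs_self _).trans (abs_sin_sub_sin_le (2 * x) (2 * y))
    rw [abs_of_nonpos h] at this
    linarith
  have h4 : sin (2 * x) / (2 * π) - sin (2 * y) / (2 * π) ≤ 2 * (y - x) / (2 * π) := by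
    rw [← sub_div]; gcongr
  have h5 : y - θ - (x - θ) = y - x := by ring
  have h6 : y + θ - (x + θ) = y - x := by ring
  rw [h5] at h1
  rw [h6] at h2
  have h7 : 2 / π * (y - x) =
      (y - x) / (2 * π) + (y - x) / (2 * π) + 2 * (y - x) / (2 * π) := by
    field_simp; ring
  rw [angleDiscrepancy, angleDiscrepancy, h7]
  linarith

lemma angleDiscrepancy_eq_indicator_sub {θ x : ℝ} (hθ : θ ∈ Set.Icc 0 π) (h0 : 0 ≤ x)
    (hx : x < π) :
    angleDiscrepancy θ x = (if θ ≤ x then 1 else 0) - satoTateCDF x := by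
  have hπ := pi_pos
  have h2 := saw_of_mem_Ico (x := x + θ) (by linarith [hθ.1]) (by linarith [hθ.2])
  rw [angleDiscrepancy, satoTateCDF, h2]
  split_ifs with h
  · rw [saw_of_mem_Ico (by linarith) (by linarith [hθ.1])]
    field_simp; ring
  · rw [← saw_periodic, saw_of_mem_Ico (by linarith [hθ.2]) (by linarith)]
    field_simp; ring

lemma neg_angleDiscrepancy_neg_eq_indicator_sub {θ x : ℝ} (hθ : θ ∈ Set.Icc 0 π) (h0 : 0 < x)
    (hx : x ≤ π) :
    -angleDiscrepancy θ (-x) = (if θ < x then 1 else 0) - satoTateCDF x := by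
  have hπ := pi_pos
  have h1 : saw (-x - θ) = 1 / 2 - (-x - θ + 2 * π) / (2 * π) := by
    rw [← saw_periodic, saw_of_mem_Ico (by linarith [hθ.2]) (by linarith [hθ.1])]
  have h3 : sin (2 * -x) = -sin (2 * x) := by rw [mul_neg, sin_neg]
  rw [angleDiscrepancy, satoTateCDF, h1, h3]
  split_ifs with h
  · rw [← saw_periodic (-x + θ), saw_of_mem_Ico (by linarith [hθ.1]) (by linarith)]
    field_simp; ring
  · rw [saw_of_mem_Ico (by linarith) (by linarith [hθ.2])]
    field_simp; ring

/-- The difference `U_d - U_{d-2}`, without the constant `U_0` and `U_{-1}` terms. -/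
def chebyshevUDiff (d : ℕ) (w : ℝ) : ℝ :=
  (Chebyshev.U ℝ (d : ℤ)).eval w - if 3 ≤ d then (Chebyshev.U ℝ ((d - 2 : ℕ) : ℤ)).eval w else 0

lemma chebyshevUDiff_cos {d : ℕ} (hd : d ≠ 0) (θ : ℝ) :
    chebyshevUDiff d (cos θ) = 2 * cos (d * θ) + if d = 2 then 1 else 0 := by
  obtain rfl | rfl | h : d = 1 ∨ d = 2 ∨ 3 ≤ d := by omega
  · simp [chebyshevUDiff]
  · simp [chebyshevUDiff, Chebyshev.U_two, cos_two_mul]; ring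
  · obtain ⟨n, rfl⟩ := Nat.exists_eq_add_of_le' (show 2 ≤ d by omega)
    have h1 := congrArg (eval (cos θ)) (Chebyshev.two_mul_T_eq_U_sub_U ℝ (n : ℤ))
    have h2 := Chebyshev.T_real_cos θ ((n : ℤ) + 2)
    simp only [eval_mul, eval_sub, eval_ofNat, h2] at h1
    rw [chebyshevUDiff, if_pos h, if_neg (by omega), Nat.add_sub_cancel]
    push_cast at h1 ⊢
    linarith

lemma integral_angleDiscrepancy (θ c : ℝ) : ∫ t in (-π)..π, angleDiscrepancy θ (c + t) = 0 := by
  have hs : ∀ u, IntervalIntegrable (fun t => saw (u + t)) volume (-π) π := fun u => by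
    simpa using (intervalIntegrable_saw (u + -π) (u + π)).comp_add_left u
  have h1 : ∀ t, angleDiscrepancy θ (c + t) =
      saw (c - θ + t) + saw (c + θ + t) + sin (2 * (c + t)) * cos ((0 : ℕ) * t) / (2 * π) := by
    intro t
    simp only [angleDiscrepancy, Nat.cast_zero, zero_mul, cos_zero, mul_one]
    congr 3 <;> ring
  simp only [h1]
  rw [integral_add ((hs _).add (hs _)) (Continuous.intervalIntegrable (by fun_prop) _ _),
    integral_add (hs _) (hs _), integral_saw, integral_saw, intervalIntegral.integral_div,
    integral_sin_two_mul_mul_cos]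
  simp

lemma integral_angleDiscrepancy_mul_cos (θ c : ℝ) {d : ℕ} (hd : d ≠ 0) :
    ∫ t in (-π)..π, angleDiscrepancy θ (c + t) * cos (d * t) =
      sin (d * c) / d * chebyshevUDiff d (cos θ) := by
  have hπ := pi_pos.ne'
  have hd' : (d : ℝ) ≠ 0 := by exact_mod_cast hd
  have hs : ∀ u, IntervalIntegrable (fun t => saw (u + t) * cos (d * t)) volume (-π) π :=
    fun u => IntervalIntegrable.mul_continuousOn
      (by simpa using (intervalIntegrable_saw (u + -π) (u + π)).comp_add_left u)
      (by fun_prop)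
  have h1 : ∀ t, angleDiscrepancy θ (c + t) * cos (d * t) =
      saw (c - θ + t) * cos (d * t) + saw (c + θ + t) * cos (d * t) +
        sin (2 * (c + t)) * cos (d * t) / (2 * π) := by
    intro t
    have e1 : c + t - θ = c - θ + t := by ring
    have e2 : c + t + θ = c + θ + t := by ring
    rw [angleDiscrepancy, e1, e2]
    ring
  simp only [h1]
  rw [integral_add ((hs _).add (hs _)) (Continuous.intervalIntegrable (by fun_prop) _ _),
    integral_add (hs _) (hs _), integral_saw_mul_cos _ hd, integral_saw_mul_cos _ hd,
    intervalIntegral.integral_div, integral_sin_two_mul_mul_cos, chebyshevUDiff_cos hd,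
    mul_sub, mul_add, sin_sub, sin_add]
  split_ifs with h
  · subst h
    push_cast
    field_simp
    ring
  · field_simp
    ring

lemma sum_shift_two_div_le {g : ℕ → ℝ} (hg : ∀ n, 0 ≤ g n) (k : ℕ) :
    ∑ d ∈ Finset.Icc 1 k, (if 3 ≤ d then g (d - 2) / d else 0) ≤
      ∑ n ∈ Finset.Icc 1 k, g n / n := by
  have h : ∀ k : ℕ, ∑ d ∈ Finset.Icc 1 (k + 2), (if 3 ≤ d then g (d - 2) / d else 0) ≤
      ∑ n ∈ Finset.Icc 1 k, g n / n := by
    intro k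
    induction k with
    | zero => simp [Finset.sum_Icc_succ_top]
    | succ k ih =>
      have e : k + 2 + 1 - 2 = k + 1 := by omega
      rw [show k + 1 + 2 = (k + 2) + 1 from rfl,
        Finset.sum_Icc_succ_top (show 1 ≤ k + 2 + 1 by omega),
        Finset.sum_Icc_succ_top (show 1 ≤ k + 1 by omega), if_pos (by omega), e]
      refine add_le_add ih ?_
      have := hg (k + 1)
      gcongr
      omega
  refine le_trans (Finset.sum_le_sum_of_subset_of_nonneg
    (Finset.Icc_subset_Icc_right (Nat.le_add_right k 2)) fun d _ _ => ?_) (h k)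
  have := hg (d - 2)
  split_ifs <;> positivity

lemma sum_abs_sum_chebyshevUDiff_le {m : ℕ} (w : Fin m → ℝ) (k : ℕ) :
    ∑ d ∈ Finset.Icc 1 k, |∑ i, chebyshevUDiff d (w i)| / d ≤
      2 * ∑ n ∈ Finset.Icc 1 k, |∑ i, (Chebyshev.U ℝ (n : ℤ)).eval (w i)| / n := by
  have h := sum_shift_two_div_le
    (g := fun n => |∑ i, (Chebyshev.U ℝ (n : ℤ)).eval (w i)|) (fun n => abs_nonneg _) k
  rw [two_mul]
  refine le_trans ?_ (add_le_add_right h _)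
  rw [← Finset.sum_add_distrib]
  refine Finset.sum_le_sum fun d _ => ?_
  simp only [chebyshevUDiff, Finset.sum_sub_distrib]
  split_ifs with hd
  · rw [← add_div]
    gcongr
    exact abs_sub _ _
  · simp

lemma abs_integral_sum_angleDiscrepancy_mul_fejer_le {m : ℕ} (θ : Fin m → ℝ) {k : ℕ}
    (hk : 0 < k) (c : ℝ) :
    |∫ t in (-π)..π, (∑ i, angleDiscrepancy (θ i) (c + t)) * fejer k t| ≤
      4 * ∑ n ∈ Finset.Icc 1 k, |∑ i, (Chebyshev.U ℝ (n : ℤ)).eval (cos (θ i))| / n := by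
  have hk' : (0 : ℝ) < k := by positivity
  have hint : ∀ i, IntervalIntegrable (fun t => angleDiscrepancy (θ i) (c + t))
      volume (-π) π := fun i => by
    simpa using (intervalIntegrable_angleDiscrepancy (θ i) (c + -π) (c + π)).comp_add_left c
  have hsum : IntervalIntegrable (fun t => ∑ i, angleDiscrepancy (θ i) (c + t))
      volume (-π) π := by
    have := IntervalIntegrable.sum Finset.univ
      (f := fun i t => angleDiscrepancy (θ i) (c + t)) fun i _ => hint i
    simpa only [Finset.sum_fn] using this
  have hcoef : ∀ d ∈ Finset.Icc 1 k,
      ∫ t in (-π)..π, (∑ i, angleDiscrepancy (θ i) (c + t)) * cos (d * t) =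
        sin (d * c) / d * ∑ i, chebyshevUDiff d (cos (θ i)) := fun d hd => by
    have hd0 : d ≠ 0 := by have := Finset.mem_Icc.1 hd; omega
    simp only [Finset.sum_mul]
    rw [intervalIntegral.integral_finsetSum fun i _ => (hint i).mul_continuousOn (by fun_prop), Finset.mul_sum]
    exact Finset.sum_congr rfl fun i _ => integral_angleDiscrepancy_mul_cos _ _ hd0
  rw [integral_mul_fejer hsum, intervalIntegral.integral_finsetSum fun i _ => hint i]
  simp only [integral_angleDiscrepancy, Finset.sum_const_zero, zero_add]
  rw [abs_mul, abs_two]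
  have hle := sum_abs_sum_chebyshevUDiff_le (fun i => cos (θ i)) k
  have : |∑ d ∈ Finset.Icc 1 k, (1 - (d : ℝ) / k) *
      ∫ t in (-π)..π, (∑ i, angleDiscrepancy (θ i) (c + t)) * cos (d * t)| ≤
      ∑ d ∈ Finset.Icc 1 k, |∑ i, chebyshevUDiff d (cos (θ i))| / d := by
    refine (Finset.abs_sum_le_sum_abs _ _).trans (Finset.sum_le_sum fun d hd => ?_)
    have hdk : (d : ℝ) ≤ k := by exact_mod_cast (Finset.mem_Icc.1 hd).2
    have h1 : |1 - (d : ℝ) / k| ≤ 1 := by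
      have h2 : (d : ℝ) / k ≤ 1 := (div_le_one hk').2 hdk
      have h3 : 0 ≤ (d : ℝ) / k := by positivity
      rw [abs_le]
      constructor <;> linarith
    rw [hcoef d hd, abs_mul, abs_mul, abs_div, Nat.abs_cast]
    calc |1 - (d : ℝ) / k| * (|sin (d * c)| / d * |∑ i, chebyshevUDiff d (cos (θ i))|)
        ≤ 1 * (1 / d * |∑ i, chebyshevUDiff d (cos (θ i))|) := by
          gcongr
          exact abs_sin_le_one _
      _ = _ := by ring
  linarith

lemma abs_sum_angleDiscrepancy_le {m : ℕ} (θ : Fin m → ℝ) {k : ℕ} (hk : 0 < k) (x : ℝ) :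
    |∑ i, angleDiscrepancy (θ i) x| ≤ 32 * π * (m / k +
      ∑ n ∈ Finset.Icc 1 k, 1 / (n : ℝ) * |∑ i, (Chebyshev.U ℝ (n : ℤ)).eval (cos (θ i))|) := by
  have hπ := pi_pos
  set S := ∑ n ∈ Finset.Icc 1 k, |∑ i, (Chebyshev.U ℝ (n : ℤ)).eval (cos (θ i))| / n with hS
  have hS' : ∑ n ∈ Finset.Icc 1 k,
      1 / (n : ℝ) * |∑ i, (Chebyshev.U ℝ (n : ℤ)).eval (cos (θ i))| = S :=
    Finset.sum_congr rfl fun n _ => by ring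
  have hS0 : 0 ≤ S := Finset.sum_nonneg fun n _ => by positivity
  have h := abs_le_of_abs_integral_mul_fejer_le (f := fun x => ∑ i, angleDiscrepancy (θ i) x)
    (D := m * 2) (L := m * (2 / π)) (E := 2 * S / π) hk
    (fun a b => by
      have := IntervalIntegrable.sum Finset.univ
        (f := fun i => angleDiscrepancy (θ i)) fun i _ =>
          intervalIntegrable_angleDiscrepancy (θ i) a b
      simpa only [Finset.sum_fn] using this)
    (fun x => (Finset.abs_sum_le_sum_abs _ _).trans
      ((Finset.sum_le_sum fun i _ => abs_angleDiscrepancy_le (θ i) x).trans (by simp)))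
    (by positivity)
    (fun x y hxy => by
      have := Finset.sum_le_sum fun i (_ : i ∈ Finset.univ) => angleDiscrepancy_sub_le (θ i) hxy
      rw [Finset.sum_sub_distrib] at this
      simpa [mul_assoc] using this)
    (fun c => by
      have e : 2 * π * (2 * S / π) = 4 * S := by field_simp; ring
      rw [e]
      exact abs_integral_sum_angleDiscrepancy_mul_fejer_le θ hk c)
    x
  rw [hS']
  refine h.trans ?_
  have h1 : 2 * S / π ≤ 16 * π * S := by
    rw [div_le_iff₀ hπ]
    have := two_le_pi
    have : 1 ≤ π * π := by nlinarith
    nlinarith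
  have h2 : 8 * π ^ 2 * (m * (2 / π)) / k = 16 * π * (m / k) := by field_simp; ring
  rw [h2]
  linarith

lemma integral_sqrt_one_sub_sq_eq_satoTateCDF {a b : ℝ} (ha : -1 ≤ a) (hab : a < b)
    (hb : b ≤ 1) :
    2 / π * ∫ z in a..b, √(1 - z ^ 2) =
      satoTateCDF (arccos a) - satoTateCDF (arccos b) := by
  have hπ := pi_pos.ne'
  have h := integral_comp_mul_deriv (a := arccos b) (b := arccos a) (f := cos)
    (f' := fun x => -sin x) (g := fun z => √(1 - z ^ 2))
    (fun x _ => hasDerivAt_cos x) (by fun_prop) (by fun_prop)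
  rw [cos_arccos (by linarith) hb, cos_arccos ha (by linarith), integral_symm a b] at h
  have hle : arccos b ≤ arccos a := arccos_le_arccos hab.le
  have h2 : ∫ x in (arccos b)..(arccos a), ((fun z => √(1 - z ^ 2)) ∘ cos) x * -sin x =
      ∫ x in (arccos b)..(arccos a), -(sin x ^ 2) := by
    refine integral_congr fun x hx => ?_
    rw [Set.uIcc_of_le hle] at hx
    have hs := sin_nonneg_of_nonneg_of_le_pi ((arccos_nonneg b).trans hx.1)
      (hx.2.trans (arccos_le_pi a))
    have : 1 - cos x ^ 2 = sin x ^ 2 := by rw [sin_sq]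
    simp only [Function.comp, this, sqrt_sq hs]
    ring
  rw [h2, intervalIntegral.integral_neg, neg_inj, integral_sin_sq] at h
  rw [← h, satoTateCDF, satoTateCDF, sin_two_mul, sin_two_mul]
  field_simp
  ring

/-- The discrepancy of the points `cos (θ i)` with respect to the Sato–Tate measure is controlled
by the uniform norm of the total angle discrepancy. -/
lemma abs_card_sub_mul_satoTateCDF_le {m : ℕ} {θ : Fin m → ℝ} (hθ : ∀ i, θ i ∈ Set.Icc 0 π)
    {B : ℝ} (hB : ∀ x, |∑ i, angleDiscrepancy (θ i) x| ≤ B) {α β : ℝ} (hα : 0 ≤ α)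
    (hαβ : α < β) (hβ : β ≤ π) :
    |((Finset.univ.filter fun i => θ i ∈ Set.Icc α β).card : ℝ) -
      m * (satoTateCDF β - satoTateCDF α)| ≤ 2 * B := by
  have hπ := pi_pos
  have hB0 : 0 ≤ B := (abs_nonneg _).trans (hB 0)
  have hupper : |∑ i, ((if θ i ≤ β then (1 : ℝ) else 0) - satoTateCDF β)| ≤ B := by
    rcases hβ.lt_or_eq with h | rfl
    · rw [Finset.sum_congr rfl fun i _ =>
        (angleDiscrepancy_eq_indicator_sub (hθ i) (hα.trans hαβ.le) h).symm]
      exact hB β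
    · rw [Finset.sum_eq_zero fun i _ => by simp [(hθ i).2, satoTateCDF, hπ.ne']]
      simpa using hB0
  have hlower : |∑ i, ((if θ i < α then (1 : ℝ) else 0) - satoTateCDF α)| ≤ B := by
    rcases hα.lt_or_eq with h | rfl
    · rw [Finset.sum_congr rfl fun i _ =>
        (neg_angleDiscrepancy_neg_eq_indicator_sub (hθ i) h (hαβ.le.trans hβ)).symm,
        Finset.sum_neg_distrib, abs_neg]
      exact hB (-α)
    · rw [Finset.sum_eq_zero fun i _ => by simp [(hθ i).1.not_gt, satoTateCDF]]
      simpa using hB0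
  have hcard : ((Finset.univ.filter fun i => θ i ∈ Set.Icc α β).card : ℝ) -
      m * (satoTateCDF β - satoTateCDF α) =
      ∑ i, ((if θ i ≤ β then (1 : ℝ) else 0) - satoTateCDF β) -
        ∑ i, ((if θ i < α then (1 : ℝ) else 0) - satoTateCDF α) := by
    have h1 : ∀ i, (if θ i ∈ Set.Icc α β then (1 : ℝ) else 0) =
        (if θ i ≤ β then 1 else 0) - (if θ i < α then 1 else 0) := fun i => by
      by_cases h1 : θ i ≤ β <;> by_cases h2 : θ i < α
      · simp [h1, h2]
      · simp [h1, h2, not_lt.1 h2]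
      · linarith
      · simp [h1, h2]
    rw [Finset.card_filter]
    push_cast
    simp only [h1, Finset.sum_sub_distrib, Finset.sum_const, Finset.card_univ,
      Fintype.card_fin, nsmul_eq_mul]
    ring
  rw [hcard]
  exact (abs_sub _ _).trans (by linarith)

end Discrepancy

/-- Lemma 2.7 (after Niederreiter): a discrepancy bound for points of `[-1,1]`
with respect to the Sato–Tate measure, in terms of sums of Chebyshev
polynomials of the second kind. -/
theorem niederreiter_discrepancy :
    ∃ C : ℝ, 0 < C ∧ ∀ m : ℕ, 0 < m → ∀ w : Fin m → ℝ,
      (∀ i, w i ∈ Set.Icc (-1 : ℝ) 1) → ∀ k : ℕ, 0 < k →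
      ∀ a b : ℝ, -1 ≤ a → a < b → b ≤ 1 →
        |(((Finset.univ.filter fun i => w i ∈ Set.Icc a b).card : ℕ) : ℝ) -
            m * ((2 / Real.pi) * ∫ z in a..b, Real.sqrt (1 - z ^ 2))| ≤
          C * ((m : ℝ) / k + ∑ n ∈ Finset.Icc 1 k,
            (1 / (n : ℝ)) * |∑ i, (Polynomial.Chebyshev.U ℝ (n : ℤ)).eval (w i)|) := by
  refine ⟨64 * Real.pi, by positivity, fun m _ w hw k hk a b ha hab hb => ?_⟩
  have hcos : ∀ i, Real.cos (Real.arccos (w i)) = w i := fun i =>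
    Real.cos_arccos (hw i).1 (hw i).2
  have hbound := abs_card_sub_mul_satoTateCDF_le (θ := fun i => Real.arccos (w i))
    (fun i => ⟨Real.arccos_nonneg _, Real.arccos_le_pi _⟩)
    (abs_sum_angleDiscrepancy_le (fun i => Real.arccos (w i)) hk)
    (Real.arccos_nonneg b) (Real.arccos_lt_arccos ha hab hb) (Real.arccos_le_pi a)
  have hmem : ∀ i, Real.arccos (w i) ∈ Set.Icc (Real.arccos b) (Real.arccos a) ↔
      w i ∈ Set.Icc a b := fun i => by
    have h1 := Real.strictAntiOn_arccos.le_iff_ge (a := b) (b := w i) ⟨by linarith, hb⟩ (hw i)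
    have h2 := Real.strictAntiOn_arccos.le_iff_ge (a := w i) (b := a) (hw i) ⟨ha, by linarith⟩
    rw [Set.mem_Icc, Set.mem_Icc, h1, h2, and_comm]
  simp only [hcos, hmem, ← integral_sqrt_one_sub_sq_eq_satoTateCDF ha hab hb] at hbound
  refine hbound.trans (le_of_eq ?_)
  ring
end
end
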